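/- arXiv:1512.05442 — 2 statements merged into one kernel-verified Lean document; each statement's English description precedes it below -/
import Mathlib

section
/- Let K be an n-polytope in ℝ^n such that V(L,M,K[n−2])·V_n(K) ≤ V(L,K[n−1])·V(M,K[n−1]) holds for all convex bodies L and M in ℝ^n. Then K is a simplex. -/
open Pointwise MeasureTheory

/-- The mixed volume of an `n`-tuple of sets in `ℝⁿ`, via the polarization formula. -/
noncomputable def mixedVol (n : ℕ) (K : Fin n → Set (EuclideanSpace ℝ (Fin n))) : ℝ :=
  ((n.factorial : ℝ))⁻¹ *
    ∑ S : Finset (Fin n), (-1 : ℝ) ^ (n - S.card) * (volume (∑ i ∈ S, K i)).toReal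

/-- A convex body: a nonempty compact convex set. -/
def IsConvexBody {n : ℕ} (K : Set (EuclideanSpace ℝ (Fin n))) : Prop :=
  Convex ℝ K ∧ IsCompact K ∧ K.Nonempty

section

open Set Filter Topology ENNReal

/-- One-dimensional Brunn–Minkowski inequality. -/
theorem Real.volume_add_volume_le {A B C : Set ℝ} (hA : A.Nonempty) (hB : B.Nonempty)
    (mA : MeasurableSet A) (mB : MeasurableSet B) (h : A + B ⊆ C) :
    volume A + volume B ≤ volume C := by
  have left (a : ℝ) (ha : a ∈ A) : volume B ≤ volume C := by
    rw [← measure_preimage_add volume (-a) B]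
    refine measure_mono fun x hx => h ⟨a, ha, -a + x, hx, by simp⟩
  have right (b : ℝ) (hb : b ∈ B) : volume A ≤ volume C := by
    rw [← measure_preimage_add volume (-b) A]
    refine measure_mono fun x hx => h ⟨-b + x, hx, b, hb, by simp⟩
  rcases eq_or_ne (volume A) 0 with h0 | hA0
  · rw [h0, zero_add]; exact left _ hA.some_mem
  rcases eq_or_ne (volume B) 0 with h0 | hB0
  · rw [h0, add_zero]; exact right _ hB.some_mem
  refine le_of_forall_lt fun c hc => ?_
  obtain ⟨a, haA, b, hbB, hab⟩ := ENNReal.exists_lt_add_of_lt_add hc hA0 hB0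
  obtain ⟨A', hA'A, cA, haA'⟩ := mA.exists_lt_isCompact haA
  obtain ⟨B', hB'B, cB, hbB'⟩ := mB.exists_lt_isCompact hbB
  have nA : A'.Nonempty := nonempty_of_measure_ne_zero (ne_bot_of_gt haA')
  have nB : B'.Nonempty := nonempty_of_measure_ne_zero (ne_bot_of_gt hbB')
  obtain ⟨x, hxA, hx⟩ := cA.exists_isMaxOn nA continuousOn_id
  obtain ⟨y, hyB, hy⟩ := cB.exists_isMinOn nB continuousOn_id
  have hx' : ∀ z ∈ A', z ≤ x := fun z hz => hx hz
  have hy' : ∀ z ∈ B', y ≤ z := fun z hz => hy hz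
  have e1 : volume ((fun z => -y + z) ⁻¹' A') = volume A' := measure_preimage_add _ _ _
  have e2 : volume ((fun z => -x + z) ⁻¹' B') = volume B' := measure_preimage_add _ _ _
  have hd : AEDisjoint volume ((fun z => -y + z) ⁻¹' A') ((fun z => -x + z) ⁻¹' B') := by
    refine measure_mono_null (t := {x + y}) (fun z hz => ?_) (measure_singleton _)
    have h1 := hx' _ hz.1
    have h2 := hy' _ hz.2
    simp only [mem_singleton_iff]
    linarith
  have hm : MeasurableSet ((fun z => -x + z) ⁻¹' B') :=
    measurable_const_add (-x) cB.measurableSet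
  calc c < a + b := hab
    _ ≤ volume A' + volume B' := add_le_add haA'.le hbB'.le
    _ = volume (((fun z => -y + z) ⁻¹' A') ∪ ((fun z => -x + z) ⁻¹' B')) := by
      rw [measure_union₀ hm.nullMeasurableSet hd, e1, e2]
    _ ≤ volume C := by
      refine measure_mono (union_subset (fun z hz => ?_) fun z hz => ?_)
      · exact h ⟨-y + z, hA'A hz, y, hB'B hyB, by simp⟩
      · exact h ⟨x, hA'A hxA, -x + z, hB'B hz, by simp⟩

theorem ENNReal.rpow_mul_rpow_le_add {s : ℝ} (hs0 : 0 < s) (hs1 : s < 1) (x y : ℝ≥0∞) :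
    x ^ (1 - s) * y ^ s ≤ ENNReal.ofReal (1 - s) * x + ENNReal.ofReal s * y := by
  have h1 : 0 < 1 - s := by linarith
  rcases eq_or_ne x ⊤ with rfl | hx
  · rw [ENNReal.mul_top (by simpa using hs1)]; simp
  rcases eq_or_ne y ⊤ with rfl | hy
  · rw [ENNReal.mul_top (by simpa using hs0)]; simp
  lift x to NNReal using hx
  lift y to NNReal using hy
  have := NNReal.geom_mean_le_arith_mean2_weighted ⟨1 - s, h1.le⟩ ⟨s, hs0.le⟩ x y
    (NNReal.coe_injective (by change 1 - s + s = 1; ring))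
  rw [← ENNReal.coe_rpow_of_nonneg _ h1.le, ← ENNReal.coe_rpow_of_nonneg _ hs0.le,
    ENNReal.ofReal_eq_coe_nnreal h1.le, ENNReal.ofReal_eq_coe_nnreal hs0.le]
  exact_mod_cast this

/-- The Prékopa–Leindler inequality holds for the measure `μ`. -/
def PrekopaLeindler {E : Type*} [AddCommGroup E] [Module ℝ E] [MeasurableSpace E]
    (μ : Measure E) : Prop :=
  ∀ s : ℝ, 0 < s → s < 1 → ∀ f g h : E → ℝ≥0∞, Measurable f → Measurable g → Measurable h →
    (∀ x y, f x ^ (1 - s) * g y ^ s ≤ h ((1 - s) • x + s • y)) →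
    (∫⁻ x, f x ∂μ) ^ (1 - s) * (∫⁻ x, g x ∂μ) ^ s ≤ ∫⁻ x, h x ∂μ

theorem lintegral_add_le_of_sup_eq_one {s : ℝ} (hs0 : 0 < s) (hs1 : s < 1) {F G H : ℝ → ℝ}
    (mF : Measurable F) (mG : Measurable G) (mH : Measurable H)
    (F0 : ∀ x, 0 ≤ F x) (G0 : ∀ x, 0 ≤ G x) (H0 : ∀ x, 0 ≤ H x)
    (F1 : ∀ x, F x ≤ 1) (G1 : ∀ x, G x ≤ 1)
    (hF : ∀ t < 1, ∃ x, t < F x) (hG : ∀ t < 1, ∃ x, t < G x)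
    (h : ∀ x y, F x ^ (1 - s) * G y ^ s ≤ H ((1 - s) * x + s * y)) :
    ENNReal.ofReal (1 - s) * (∫⁻ x, ENNReal.ofReal (F x)) +
      ENNReal.ofReal s * (∫⁻ x, ENNReal.ofReal (G x)) ≤ ∫⁻ x, ENNReal.ofReal (H x) := by
  have h1 : 0 < 1 - s := by linarith
  rw [lintegral_eq_lintegral_meas_lt _ (Eventually.of_forall F0) mF.aemeasurable,
    lintegral_eq_lintegral_meas_lt _ (Eventually.of_forall G0) mG.aemeasurable,
    lintegral_eq_lintegral_meas_lt _ (Eventually.of_forall H0) mH.aemeasurable]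
  have anti (F : ℝ → ℝ) : Measurable fun t : ℝ => volume {a | t < F a} := by
    refine Antitone.measurable fun t u htu => measure_mono fun a ha => lt_of_le_of_lt htu ha
  rw [← lintegral_const_mul _ (anti F), ← lintegral_const_mul _ (anti G), ← lintegral_add_left
    ((anti F).const_mul _)]
  refine setLIntegral_mono' measurableSet_Ioi fun t ht => ?_
  have ht0 : 0 < t := ht
  rcases lt_or_ge t 1 with ht1 | ht1
  · have e (r : ℝ) (hr : 0 < r) (A : Set ℝ) :
        volume (r • A) = ENNReal.ofReal r * volume A := by
      rw [Measure.addHaar_smul]; simp [abs_of_pos hr]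
    rw [← e _ h1, ← e _ hs0]
    refine Real.volume_add_volume_le (Nonempty.smul_set (hF t ht1))
      (Nonempty.smul_set (hG t ht1))
      ((measurableSet_lt measurable_const mF).const_smul₀ _)
      ((measurableSet_lt measurable_const mG).const_smul₀ _) ?_
    rintro _ ⟨_, ⟨x, hx, rfl⟩, _, ⟨y, hy, rfl⟩, rfl⟩
    refine lt_of_lt_of_le ?_ (h x y)
    calc t = t ^ (1 - s) * t ^ s := by rw [← Real.rpow_add ht0]; simp
      _ < _ := mul_lt_mul'' (Real.rpow_lt_rpow ht0.le hx h1) (Real.rpow_lt_rpow ht0.le hy hs0)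
        (by positivity) (by positivity)
  · have e (F : ℝ → ℝ) (F1 : ∀ x, F x ≤ 1) : {a | t < F a} = ∅ := by
      ext a; simpa using (F1 a).trans ht1
    simp [e F F1, e G G1]

theorem prekopaLeindler_real_of_bounded {s : ℝ} (hs0 : 0 < s) (hs1 : s < 1) {f g h : ℝ → ℝ≥0∞}
    (mf : Measurable f) (mg : Measurable g) (mh : Measurable h)
    (bf : ⨆ x, f x ≠ ⊤) (bg : ⨆ x, g x ≠ ⊤)
    (H : ∀ x y, f x ^ (1 - s) * g y ^ s ≤ h ((1 - s) * x + s * y)) :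
    (∫⁻ x, f x) ^ (1 - s) * (∫⁻ x, g x) ^ s ≤ ∫⁻ x, h x := by
  have h1 : 0 < 1 - s := by linarith
  set α := ⨆ x, f x with hα
  set β := ⨆ x, g x with hβ
  rcases eq_or_ne α 0 with h0 | α0
  · have : f = fun _ => 0 := by
      ext x; exact le_antisymm (h0 ▸ le_iSup f x) zero_le
    simp [this, h1]
  rcases eq_or_ne β 0 with h0 | β0
  · have : g = fun _ => 0 := by
      ext x; exact le_antisymm (h0 ▸ le_iSup g x) zero_le
    simp [this, hs0]
  set γ := α ^ (1 - s) * β ^ s with hγ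
  have γ0 : γ ≠ 0 := by simp [hγ, α0, β0, bf, bg]
  have γt : γ ≠ ⊤ := ENNReal.mul_ne_top (ENNReal.rpow_ne_top_of_nonneg h1.le bf)
    (ENNReal.rpow_ne_top_of_nonneg hs0.le bg)
  have key (f : ℝ → ℝ≥0∞) (mf : Measurable f) (α0 : ⨆ x, f x ≠ 0) (bf : ⨆ x, f x ≠ ⊤) :
      (∀ x, f x / (⨆ x, f x) ≤ 1) ∧
      (∀ t < 1, ∃ x, t < (f x / ⨆ x, f x).toReal) ∧
      ∫⁻ x, f x = (⨆ x, f x) * ∫⁻ x, ENNReal.ofReal (f x / ⨆ x, f x).toReal := by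
    have le1 (x) : f x / (⨆ x, f x) ≤ 1 := ENNReal.div_le_of_le_mul (by simpa using le_iSup f x)
    refine ⟨le1, fun t ht => ?_, ?_⟩
    · rcases lt_or_ge t 0 with h0 | h0
      · exact ⟨0, h0.trans_le ENNReal.toReal_nonneg⟩
      · have : ENNReal.ofReal t * (⨆ x, f x) < ⨆ x, f x := by
          conv_rhs => rw [← one_mul (⨆ x, f x)]
          exact (ENNReal.mul_lt_mul_iff_left α0 bf).2 (by simpa using ht)
        obtain ⟨x, hx⟩ := lt_iSup_iff.1 this
        refine ⟨x, ?_⟩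
        rw [← ENNReal.ofReal_lt_iff_lt_toReal h0 (ne_top_of_le_ne_top one_ne_top (le1 x))]
        rwa [ENNReal.lt_div_iff_mul_lt (Or.inl α0) (Or.inl bf)]
    · rw [← lintegral_const_mul _ (by fun_prop)]
      congr with x
      rw [ENNReal.ofReal_toReal (ne_top_of_le_ne_top one_ne_top (le1 x)),
        ENNReal.mul_div_cancel α0 bf]
  obtain ⟨fle, fsup, fint⟩ := key f mf α0 bf
  obtain ⟨gle, gsup, gint⟩ := key g mg β0 bg
  have main := lintegral_add_le_of_sup_eq_one hs0 hs1 (F := fun x => (f x / α).toReal)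
    (G := fun x => (g x / β).toReal) (H := fun x => (min (h x / γ) 1).toReal)
    (by fun_prop) (by fun_prop) (by fun_prop) (fun _ => toReal_nonneg) (fun _ => toReal_nonneg)
    (fun _ => toReal_nonneg) (fun x => toReal_le_of_le_ofReal zero_le_one (by simpa using fle x))
    (fun x => toReal_le_of_le_ofReal zero_le_one (by simpa using gle x)) fsup gsup (by
      intro x y
      rw [ENNReal.toReal_rpow, ENNReal.toReal_rpow, ← ENNReal.toReal_mul]
      refine ENNReal.toReal_mono (ne_top_of_le_ne_top one_ne_top (min_le_right _ _))
        (le_min ?_ ?_)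
      · rw [ENNReal.div_rpow_of_nonneg _ _ h1.le, ENNReal.div_rpow_of_nonneg _ _ hs0.le,
          ENNReal.le_div_iff_mul_le (Or.inl γ0) (Or.inl γt), hγ]
        refine le_trans (le_of_eq ?_) (H x y)
        have a0 : α ^ (1 - s) ≠ 0 := by simp [α0, bf]
        have b0 : β ^ s ≠ 0 := by simp [β0, bg]
        calc _ = (f x ^ (1 - s) / α ^ (1 - s) * α ^ (1 - s)) * (g y ^ s / β ^ s * β ^ s) := by ring
          _ = _ := by
            rw [ENNReal.div_mul_cancel a0 (ENNReal.rpow_ne_top_of_nonneg h1.le bf),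
              ENNReal.div_mul_cancel b0 (ENNReal.rpow_ne_top_of_nonneg hs0.le bg)]
      · exact mul_le_one' (ENNReal.rpow_le_one (fle x) h1.le) (ENNReal.rpow_le_one (gle y) hs0.le))
  rw [fint, gint, ENNReal.mul_rpow_of_nonneg _ _ h1.le, ENNReal.mul_rpow_of_nonneg _ _ hs0.le]
  calc _ = γ * ((∫⁻ x, ENNReal.ofReal (f x / α).toReal) ^ (1 - s) *
        (∫⁻ x, ENNReal.ofReal (g x / β).toReal) ^ s) := by rw [hγ]; ring
    _ ≤ γ * ∫⁻ x, ENNReal.ofReal (min (h x / γ) 1).toReal := by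
      gcongr
      exact (ENNReal.rpow_mul_rpow_le_add hs0 hs1 _ _).trans main
    _ ≤ γ * ∫⁻ x, h x / γ := by
      gcongr with x
      exact (ENNReal.ofReal_toReal_le).trans (min_le_left _ _)
    _ = ∫⁻ x, h x := by
      rw [← lintegral_const_mul _ (by fun_prop)]
      congr with x
      rw [ENNReal.mul_div_cancel γ0 γt]

theorem prekopaLeindler_real : PrekopaLeindler (volume : Measure ℝ) := by
  intro s hs0 hs1 f g h mf mg mh H
  have h1 : 0 < 1 - s := by linarith
  rcases eq_or_ne (∫⁻ x, f x) 0 with h0 | f0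
  · simp [h0, h1]
  rcases eq_or_ne (∫⁻ x, g x) 0 with h0 | g0
  · simp [h0, hs0]
  have lim (f : ℝ → ℝ≥0∞) (mf : Measurable f) :
      Tendsto (fun N : ℕ => ∫⁻ x, min (f x) N) atTop (𝓝 (∫⁻ x, f x)) := by
    refine lintegral_tendsto_of_tendsto_of_monotone (fun N => by fun_prop)
      (Eventually.of_forall fun x N M hNM => by dsimp only; gcongr) (Eventually.of_forall fun x => ?_)
    simpa using (tendsto_const_nhds (x := f x)).min ENNReal.tendsto_nat_nhds_top
  have bd (f : ℝ → ℝ≥0∞) (N : ℕ) : ⨆ x, min (f x) N ≠ ⊤ :=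
    ne_top_of_le_ne_top (ENNReal.natCast_ne_top N) (iSup_le fun x => min_le_right _ _)
  refine le_of_tendsto (ENNReal.Tendsto.mul ((lim f mf).ennrpow_const (1 - s)) (Or.inl ?_)
    ((lim g mg).ennrpow_const s) (Or.inl ?_)) (Eventually.of_forall fun N =>
    prekopaLeindler_real_of_bounded hs0 hs1 (by fun_prop) (by fun_prop) mh (bd f N) (bd g N)
      fun x y => le_trans ?_ (H x y))
  · simp [f0, h1, hs1.le]
  · simp [g0, hs0, hs0.le]
  · gcongr <;> exact min_le_left _ _

theorem PrekopaLeindler.prod {E F : Type*} [AddCommGroup E] [Module ℝ E] [MeasurableSpace E]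
    [AddCommGroup F] [Module ℝ F] [MeasurableSpace F] {μ : Measure E} {ν : Measure F}
    [SFinite ν] (hμ : PrekopaLeindler μ) (hν : PrekopaLeindler ν) :
    PrekopaLeindler (μ.prod ν) := by
  intro s hs0 hs1 f g h mf mg mh H
  rw [lintegral_prod _ mf.aemeasurable, lintegral_prod _ mg.aemeasurable,
    lintegral_prod _ mh.aemeasurable]
  refine hμ s hs0 hs1 _ _ _ mf.lintegral_prod_right' mg.lintegral_prod_right'
    mh.lintegral_prod_right' fun x y => ?_
  exact hν s hs0 hs1 _ _ _ (mf.comp measurable_prodMk_left) (mg.comp measurable_prodMk_left)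
    (mh.comp measurable_prodMk_left) fun u v => H (x, u) (y, v)

theorem PrekopaLeindler.map {E F : Type*} [AddCommGroup E] [Module ℝ E] [MeasurableSpace E]
    [AddCommGroup F] [Module ℝ F] [MeasurableSpace F] {μ : Measure E} (hμ : PrekopaLeindler μ)
    (e : E →ₗ[ℝ] F) (he : Measurable e) : PrekopaLeindler (μ.map e) := by
  intro s hs0 hs1 f g h mf mg mh H
  rw [lintegral_map mf he, lintegral_map mg he, lintegral_map mh he]
  refine hμ s hs0 hs1 _ _ _ (mf.comp he) (mg.comp he) (mh.comp he) fun x y => ?_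
  simpa using H (e x) (e y)

theorem PrekopaLeindler.smul {E : Type*} [AddCommGroup E] [Module ℝ E] [MeasurableSpace E]
    {μ : Measure E} (hμ : PrekopaLeindler μ) (c : NNReal) : PrekopaLeindler (c • μ) := by
  intro s hs0 hs1 f g h mf mg mh H
  have h1 : 0 < 1 - s := by linarith
  rcases eq_or_ne c 0 with rfl | hc
  · simp [h1]
  simp only [lintegral_smul_measure, ENNReal.smul_def, smul_eq_mul]
  rw [ENNReal.mul_rpow_of_nonneg _ _ h1.le, ENNReal.mul_rpow_of_nonneg _ _ hs0.le,
    mul_mul_mul_comm, ← ENNReal.rpow_add _ _ (by simpa using hc) (by simp)]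
  simp only [sub_add_cancel, ENNReal.rpow_one]
  gcongr
  exact hμ s hs0 hs1 f g h mf mg mh H

theorem prekopaLeindler_pi (d : ℕ) : PrekopaLeindler (volume : Measure (Fin d → ℝ)) := by
  induction d with
  | zero =>
    intro s hs0 hs1 f g h mf mg mh H
    rw [volume_pi, Measure.pi_of_empty]
    rw [lintegral_dirac' _ mf, lintegral_dirac' _ mg, lintegral_dirac' _ mh]
    refine (H _ _).trans (le_of_eq (congrArg h (Subsingleton.elim _ _)))
  | succ d ih =>
    have hmp := (volume_preserving_piFinSuccAbove (fun _ : Fin (d + 1) => ℝ) 0).symm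
    let e : (ℝ × (Fin d → ℝ)) →ₗ[ℝ] (Fin (d + 1) → ℝ) :=
      { toFun := (MeasurableEquiv.piFinSuccAbove (fun _ => ℝ) 0).symm
        map_add' := fun x y => by
          ext i; refine Fin.cases ?_ (fun i => ?_) i <;>
            simp [MeasurableEquiv.piFinSuccAbove]
        map_smul' := fun r x => by
          ext i; refine Fin.cases ?_ (fun i => ?_) i <;>
            simp [MeasurableEquiv.piFinSuccAbove] }
    have := (prekopaLeindler_real.prod ih).map e (MeasurableEquiv.measurable _)
    rw [← hmp.map_eq]
    exact this

theorem prekopaLeindler {E : Type*} [NormedAddCommGroup E] [NormedSpace ℝ E]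
    [FiniteDimensional ℝ E] [MeasurableSpace E] [BorelSpace E] (μ : Measure E)
    [μ.IsAddHaarMeasure] : PrekopaLeindler μ := by
  let e : (Fin (Module.finrank ℝ E) → ℝ) ≃L[ℝ] E :=
    ContinuousLinearEquiv.ofFinrankEq (by simp)
  have : (Measure.map e (volume : Measure (Fin (Module.finrank ℝ E) → ℝ))).IsAddHaarMeasure :=
    e.isAddHaarMeasure_map _
  rw [Measure.isAddLeftInvariant_eq_smul μ (Measure.map e volume)]
  exact PrekopaLeindler.smul ((prekopaLeindler_pi _).map e.toLinearEquiv.toLinearMap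
    e.continuous.measurable) _

/-- The multiplicative Brunn–Minkowski inequality. -/
theorem measure_rpow_mul_le {E : Type*} [NormedAddCommGroup E] [NormedSpace ℝ E]
    [FiniteDimensional ℝ E] [MeasurableSpace E] [BorelSpace E] (μ : Measure E)
    [μ.IsAddHaarMeasure] {A B C : Set E} (hA : MeasurableSet A) (hB : MeasurableSet B)
    (hC : MeasurableSet C) {s : ℝ} (hs0 : 0 < s) (hs1 : s < 1)
    (h : (1 - s) • A + s • B ⊆ C) : μ A ^ (1 - s) * μ B ^ s ≤ μ C := by
  have h1 : 0 < 1 - s := by linarith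
  have := prekopaLeindler μ s hs0 hs1 (A.indicator 1) (B.indicator 1) (C.indicator 1)
    (measurable_one.indicator hA) (measurable_one.indicator hB) (measurable_one.indicator hC)
    (fun x y => by
      by_cases hx : x ∈ A
      · by_cases hy : y ∈ B
        · have : (1 - s) • x + s • y ∈ C :=
            h (add_mem_add (smul_mem_smul_set hx) (smul_mem_smul_set hy))
          simp [hx, hy, this]
        · simp [hy, hs0]
      · simp [hx, h1])
  simpa [lintegral_indicator_one, hA, hB, hC] using this

theorem add_zero_smul {E : Type*} [AddCommGroup E] [Module ℝ E] {X A : Set E} (hA : A.Nonempty) :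
    X + (0 : ℝ) • A = X := by
  rw [zero_smul_set hA, add_zero]

theorem interior_add_nonempty {E : Type*} [TopologicalSpace E] [AddCommGroup E]
    [IsTopologicalAddGroup E] {X A : Set E} (hX : (interior X).Nonempty) (hA : A.Nonempty) :
    (interior (X + A)).Nonempty :=
  (hX.add hA).mono
    (interior_maximal (add_subset_add interior_subset subset_rfl) isOpen_interior.add_right)

section BrunnMinkowski

variable {E : Type*} [NormedAddCommGroup E] [NormedSpace ℝ E]
    [FiniteDimensional ℝ E] [MeasurableSpace E] [BorelSpace E] (μ : Measure E)
    [μ.IsAddHaarMeasure]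

theorem measureReal_rpow_mul_le {A B : Set E} (hA : IsCompact A) (hB : IsCompact B)
    {s : ℝ} (hs0 : 0 < s) (hs1 : s < 1) :
    μ.real A ^ (1 - s) * μ.real B ^ s ≤ μ.real ((1 - s) • A + s • B) := by
  have hC : IsCompact ((1 - s) • A + s • B) := (hA.smul _).add (hB.smul _)
  have := ENNReal.toReal_mono hC.measure_ne_top (measure_rpow_mul_le μ hA.measurableSet
    hB.measurableSet hC.measurableSet hs0 hs1 subset_rfl)
  rwa [ENNReal.toReal_mul, ← ENNReal.toReal_rpow, ← ENNReal.toReal_rpow] at this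

theorem measureReal_smul {r : ℝ} (hr : 0 ≤ r) (s : Set E) :
    μ.real (r • s) = r ^ Module.finrank ℝ E * μ.real s := by
  rw [measureReal_def, Measure.addHaar_smul, ENNReal.toReal_mul, abs_of_nonneg (by positivity),
    ENNReal.toReal_ofReal (by positivity), measureReal_def]

omit [NormedSpace ℝ E] [FiniteDimensional ℝ E] [BorelSpace E] in
theorem measureReal_pos_of_interior {X : Set E} (hX : IsCompact X) (hi : (interior X).Nonempty) :
    0 < μ.real X :=
  ENNReal.toReal_pos (Measure.measure_pos_of_nonempty_interior μ hi).ne' hX.measure_ne_top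

theorem concaveOn_log_measureReal {X A : Set E} (hX : Convex ℝ X) (cX : IsCompact X)
    (hi : (interior X).Nonempty) (hA : Convex ℝ A) (cA : IsCompact A) (nA : A.Nonempty) :
    ConcaveOn ℝ (Ici 0) fun ε : ℝ => Real.log (μ.real (X + ε • A)) := by
  have pos (ε : ℝ) : 0 < μ.real (X + ε • A) := by
    refine measureReal_pos_of_interior μ (cX.add (cA.smul ε))
      (interior_add_nonempty hi nA.smul_set)
  refine ⟨convex_Ici 0, fun x hx y hy a b ha hb hab => ?_⟩
  simp only [mem_Ici, smul_eq_mul] at *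
  rcases ha.eq_or_lt with rfl | ha
  · obtain rfl : b = 1 := by linarith
    simp
  rcases hb.eq_or_lt with rfl | hb
  · obtain rfl : a = 1 := by linarith
    simp
  obtain rfl : a = 1 - b := by linarith
  have := measureReal_rpow_mul_le μ (cX.add (cA.smul x)) (cX.add (cA.smul y)) hb (by linarith)
  have e : (1 - b) • (X + x • A) + b • (X + y • A) = X + ((1 - b) * x + b * y) • A := by
    rw [hA.add_smul (by positivity) (by positivity), smul_add, smul_add, add_add_add_comm,
      ← hX.add_smul ha.le hb.le, smul_smul, smul_smul]
    simp
  rw [e] at this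
  have := Real.log_le_log (mul_pos (Real.rpow_pos_of_pos (pos _) _)
    (Real.rpow_pos_of_pos (pos _) _)) this
  rwa [Real.log_mul (Real.rpow_pos_of_pos (pos _) _).ne' (Real.rpow_pos_of_pos (pos _) _).ne',
    Real.log_rpow (pos _), Real.log_rpow (pos _)] at this

theorem exists_measureReal_add_smul_le {X A : Set E} (hX : Convex ℝ X) (cX : IsCompact X)
    (hi : (interior X).Nonempty) (cA : IsCompact A) :
    ∃ C : ℝ, 0 < C ∧ ∀ ε : ℝ, 0 ≤ ε →
      μ.real (X + ε • A) ≤ (1 + C * ε) ^ Module.finrank ℝ E * μ.real X := by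
  obtain ⟨x₀, hx₀⟩ := hi
  obtain ⟨r, hr, hball⟩ := Metric.isOpen_iff.1 isOpen_interior x₀ hx₀
  obtain ⟨R, hR, hAR⟩ := cA.isBounded.exists_pos_norm_lt
  refine ⟨R / r, by positivity, fun ε hε => ?_⟩
  have sub : X + ε • A ⊆ (1 + R / r * ε) • X + {-((R / r * ε) • x₀)} := by
    rintro _ ⟨x, hx, _, ⟨a, ha, rfl⟩, rfl⟩
    have hy : x₀ + (r / R) • a ∈ X := by
      refine interior_subset (hball ?_)
      rw [mem_ball_iff_norm, add_sub_cancel_left, norm_smul, Real.norm_of_nonneg (by positivity)]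
      calc r / R * ‖a‖ < r / R * R := by gcongr; exact hAR a ha
        _ = r := by field_simp
    rw [hX.add_smul zero_le_one (by positivity), one_smul]
    refine ⟨x + (R / r * ε) • (x₀ + (r / R) • a), add_mem_add hx (smul_mem_smul_set hy), _,
      rfl, ?_⟩
    simp only [smul_add, smul_smul]
    have : R / r * ε * (r / R) = ε := by field_simp
    rw [this]
    abel
  have h := measureReal_mono (μ := μ) sub
    ((cX.smul _).add isCompact_singleton).measure_ne_top
  rw [add_singleton, image_add_right, measureReal_def, measureReal_def, measure_preimage_add_right,
    ← measureReal_def, ← measureReal_def, measureReal_smul μ (by positivity)] at h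
  exact h

theorem exists_tendsto_measureReal_slope {X A : Set E} (hX : Convex ℝ X) (cX : IsCompact X)
    (hi : (interior X).Nonempty) (hA : Convex ℝ A) (cA : IsCompact A) (nA : A.Nonempty) :
    ∃ D : ℝ, Tendsto (fun ε : ℝ => (μ.real (X + ε • A) - μ.real X) / ε) (𝓝[>] 0) (𝓝 D) := by
  set ρ := fun ε : ℝ => Real.log (μ.real (X + ε • A)) with hρ
  have conc := concaveOn_log_measureReal μ hX cX hi hA cA nA
  have hpos := measureReal_pos_of_interior μ cX hi
  have pos (ε : ℝ) : 0 < μ.real (X + ε • A) := by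
    refine measureReal_pos_of_interior μ (cX.add (cA.smul ε))
      (interior_add_nonempty hi nA.smul_set)
  obtain ⟨C, hC, hle⟩ := exists_measureReal_add_smul_le μ hX cX hi cA
  have h0 : ρ 0 = Real.log (μ.real X) := by simp only [hρ, add_zero_smul nA]
  have anti : AntitoneOn (slope ρ 0) (Ioi 0) := by
    refine (conc.slope_anti (x := 0) (by simp)).mono fun x hx =>
      ⟨mem_Ici.2 (le_of_lt (mem_Ioi.1 hx)), ne_of_gt (mem_Ioi.1 hx)⟩
  have bdd : BddAbove (slope ρ 0 '' Ioi 0) := by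
    refine ⟨Module.finrank ℝ E * C, ?_⟩
    rintro _ ⟨ε, hε, rfl⟩
    have hε : 0 < ε := hε
    rw [slope_def_field, sub_zero, div_le_iff₀ hε, h0]
    have := Real.log_le_log (pos ε) (hle ε hε.le)
    rw [Real.log_mul (by positivity) hpos.ne', Real.log_pow] at this
    have h2 := Real.log_le_sub_one_of_pos (x := 1 + C * ε) (by positivity)
    have h3 : (Module.finrank ℝ E : ℝ) * Real.log (1 + C * ε) ≤ Module.finrank ℝ E * (C * ε) := by
      gcongr; linarith
    simp only [hρ]
    linarith
  have lim := anti.tendsto_nhdsGT bdd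
  have hd : HasDerivWithinAt ρ (sSup (slope ρ 0 '' Ioi 0)) (Ioi 0) 0 := by
    rw [hasDerivWithinAt_iff_tendsto_slope' (by simp)]; exact lim
  have hd2 := hd.exp
  rw [hasDerivWithinAt_iff_tendsto_slope' (by simp)] at hd2
  refine ⟨_, hd2.congr fun ε => ?_⟩
  rw [slope_def_field, h0, Real.exp_log hpos, sub_zero]
  simp only [hρ, Real.exp_log (pos ε)]

end BrunnMinkowski

section Slices

variable {W : Type*} [NormedAddCommGroup W] [NormedSpace ℝ W]
    [FiniteDimensional ℝ W] [MeasurableSpace W] [BorelSpace W] (ν : Measure W)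
    [ν.IsAddHaarMeasure]

omit [FiniteDimensional ℝ W] [NormedSpace ℝ W] [BorelSpace W] [ν.IsAddHaarMeasure] in
theorem measure_slice_ne_top [IsFiniteMeasureOnCompacts ν] {S : Set (ℝ × W)} (cS : IsCompact S)
    (t : ℝ) : ν (Prod.mk t ⁻¹' S) ≠ ⊤ := by
  refine ne_top_of_le_ne_top (cS.image continuous_snd).measure_ne_top
    (measure_mono fun y hy => ⟨(t, y), hy, rfl⟩)

theorem integral_le_measureReal_of_slices {S : Set (ℝ × W)} (cS : IsCompact S) {a b : ℝ}
    (hab : a ≤ b) {g : ℝ → ℝ} (cg : Continuous g) (g0 : ∀ t ∈ Icc a b, 0 ≤ g t)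
    (h : ∀ t ∈ Icc a b, g t ≤ ν.real (Prod.mk t ⁻¹' S)) :
    ∫ t in a..b, g t ≤ (volume.prod ν).real S := by
  rw [measureReal_def, ← ENNReal.ofReal_le_iff_le_toReal cS.measure_ne_top,
    intervalIntegral.integral_of_le hab, ← integral_Icc_eq_integral_Ioc,
    ofReal_integral_eq_lintegral_ofReal cg.continuousOn.integrableOn_Icc
      ((ae_restrict_iff' measurableSet_Icc).2 (Eventually.of_forall g0)),
    Measure.prod_apply cS.measurableSet]
  refine (setLIntegral_mono' measurableSet_Icc fun t ht => ?_).trans (setLIntegral_le_lintegral _ _)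
  exact (ENNReal.ofReal_le_ofReal (h t ht)).trans ENNReal.ofReal_toReal_le

theorem measureReal_le_integral_of_slices {S : Set (ℝ × W)} (cS : IsCompact S) {a b : ℝ}
    (hab : a ≤ b) {g : ℝ → ℝ} (cg : Continuous g) (hS : ∀ z ∈ S, z.1 ∈ Icc a b)
    (h : ∀ t ∈ Icc a b, ν.real (Prod.mk t ⁻¹' S) ≤ g t) :
    (volume.prod ν).real S ≤ ∫ t in a..b, g t := by
  have g0 : ∀ t ∈ Icc a b, 0 ≤ g t := fun t ht => measureReal_nonneg.trans (h t ht)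
  rw [measureReal_def]
  refine ENNReal.toReal_le_of_le_ofReal (intervalIntegral.integral_nonneg hab g0) ?_
  rw [intervalIntegral.integral_of_le hab, ← integral_Icc_eq_integral_Ioc,
    ofReal_integral_eq_lintegral_ofReal cg.continuousOn.integrableOn_Icc
      ((ae_restrict_iff' measurableSet_Icc).2 (Eventually.of_forall g0)),
    Measure.prod_apply cS.measurableSet, ← lintegral_indicator measurableSet_Icc]
  refine lintegral_mono fun t => ?_
  by_cases ht : t ∈ Icc a b
  · rw [indicator_of_mem ht]
    rw [ENNReal.le_ofReal_iff_toReal_le (measure_slice_ne_top ν cS t) (g0 t ht)]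
    exact h t ht
  · rw [indicator_of_notMem ht]
    have : Prod.mk t ⁻¹' S = ∅ := by
      ext y; simpa using fun hy => ht (hS _ hy)
    simp [this]

end Slices

section Cone

/-- The part between heights `a` and `b` of the cone over `F`, each slice being thickened by
`ε • A`. -/
def coneSlab {W : Type*} [AddCommGroup W] [Module ℝ W] (F A : Set W) (a b ε : ℝ) :
    Set (ℝ × W) :=
  {z | z.1 ∈ Icc a b ∧ z.2 ∈ z.1 • F + ε • A}

/-- The pyramid with base `{1} × F` and apex `0`. -/
def pyramid {W : Type*} [AddCommGroup W] [Module ℝ W] (F : Set W) : Set (ℝ × W) :=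
  {z | z.1 ∈ Icc (0 : ℝ) 1 ∧ z.2 ∈ z.1 • F}

variable {W : Type*} [NormedAddCommGroup W] [NormedSpace ℝ W]

theorem isCompact_coneSlab {F A : Set W} (cF : IsCompact F) (cA : IsCompact A) (a b ε : ℝ) :
    IsCompact (coneSlab F A a b ε) := by
  have h := (isCompact_Icc (a := a) (b := b)).prod (cF.prod cA)
  have e : coneSlab F A a b ε =
      (fun z : ℝ × W × W => (z.1, z.1 • z.2.1 + ε • z.2.2)) '' (Icc a b ×ˢ F ×ˢ A) := by
    ext ⟨t, y⟩
    constructor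
    · rintro ⟨ht, _, ⟨f, hf, rfl⟩, _, ⟨x, hx, rfl⟩, h⟩
      exact ⟨(t, f, x), ⟨ht, hf, hx⟩, Prod.ext rfl h⟩
    · rintro ⟨⟨t', f, x⟩, ⟨ht, hf, hx⟩, h⟩
      obtain ⟨rfl, rfl⟩ := Prod.ext_iff.1 h
      exact ⟨ht, add_mem_add (smul_mem_smul_set hf) (smul_mem_smul_set hx)⟩
  rw [e]
  exact h.image (by fun_prop)

theorem smul_pyramid_add {F A : Set W} {k : ℝ} (hk : 0 ≤ k) (ε : ℝ) :
    k • pyramid F + ε • (({0} : Set ℝ) ×ˢ A) = coneSlab F A 0 k ε := by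
  ext ⟨t, y⟩
  constructor
  · rintro ⟨_, ⟨⟨w, y⟩, ⟨hw, f, hf, hfy⟩, rfl⟩, _, ⟨⟨u, a⟩, ⟨hu, ha⟩, rfl⟩, h⟩
    obtain rfl : w • f = y := hfy
    obtain rfl : u = 0 := hu
    obtain ⟨rfl, rfl⟩ := Prod.ext_iff.1 h
    refine ⟨?_, ?_⟩
    · simp only [Prod.smul_mk, smul_eq_mul, mul_zero, Prod.mk_add_mk, add_zero] at hw ⊢
      exact ⟨mul_nonneg hk hw.1, mul_le_of_le_one_right hk hw.2⟩
    · simp only [Prod.smul_mk, smul_eq_mul, mul_zero, Prod.mk_add_mk, add_zero]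
      refine add_mem_add ⟨f, hf, ?_⟩ (smul_mem_smul_set ha)
      simp [mul_smul]
  · rintro ⟨ht, _, ⟨f, hf, rfl⟩, _, ⟨a, ha, rfl⟩, h⟩
    simp only at ht h hf
    have hkt : k * (t / k) = t := by
      rcases hk.eq_or_lt with rfl | hk
      · simpa using le_antisymm ht.1 ht.2
      · field_simp
    refine ⟨k • (t / k, (t / k) • f), smul_mem_smul_set ⟨⟨div_nonneg ht.1 hk,
      div_le_one_of_le₀ ht.2 hk⟩, smul_mem_smul_set hf⟩, ε • (0, a),
      smul_mem_smul_set ⟨rfl, ha⟩, ?_⟩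
    simp only [Prod.smul_mk, smul_eq_mul, mul_zero, Prod.mk_add_mk, add_zero, smul_smul, hkt]
    exact Prod.ext rfl h

theorem pyramid_eq_coneSlab (F : Set W) : pyramid F = coneSlab F {0} 0 1 0 := by
  ext z; simp [pyramid, coneSlab]

theorem isCompact_pyramid {F : Set W} (cF : IsCompact F) : IsCompact (pyramid F) := by
  rw [pyramid_eq_coneSlab]; exact isCompact_coneSlab cF isCompact_singleton _ _ _

theorem convex_pyramid {F : Set W} (hF : Convex ℝ F) : Convex ℝ (pyramid F) := by
  rintro ⟨t, y⟩ ⟨ht, hy⟩ ⟨u, z⟩ ⟨hu, hz⟩ a b ha hb hab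
  refine ⟨convex_Icc 0 1 ht hu ha hb hab, ?_⟩
  simp only at ht hy hu hz
  simp only [Prod.smul_mk, Prod.mk_add_mk, smul_eq_mul]
  rw [hF.add_smul (mul_nonneg ha ht.1) (mul_nonneg hb hu.1), mul_smul, mul_smul]
  exact add_mem_add (smul_mem_smul_set hy) (smul_mem_smul_set hz)

variable [FiniteDimensional ℝ W] [MeasurableSpace W] [BorelSpace W] (ν : Measure W)
    [ν.IsAddHaarMeasure]

omit [MeasurableSpace W] [BorelSpace W] in
theorem finrank_real_prod : Module.finrank ℝ (ℝ × W) = Module.finrank ℝ W + 1 := by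
  simp [add_comm]

omit [BorelSpace W] in
theorem prod_measure_height_eq_zero (k : ℝ) : (volume.prod ν) {z : ℝ × W | z.1 = k} = 0 := by
  have : {z : ℝ × W | z.1 = k} = {k} ×ˢ univ := by ext; simp
  rw [this, Measure.prod_prod]
  simp

theorem measureReal_union_of_height_le {S T : Set (ℝ × W)} (cS : IsCompact S) (cT : IsCompact T)
    (k : ℝ) (hS : ∀ z ∈ S, z.1 ≤ k) (hT : ∀ z ∈ T, k ≤ z.1) :
    (volume.prod ν).real (S ∪ T) = (volume.prod ν).real S + (volume.prod ν).real T := by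
  have hd : AEDisjoint (volume.prod ν) S T :=
    measure_mono_null (fun z hz => le_antisymm (hS z hz.1) (hT z hz.2))
      (prod_measure_height_eq_zero ν k)
  rw [measureReal_def, measure_union₀ cT.measurableSet.nullMeasurableSet hd,
    ENNReal.toReal_add cS.measure_ne_top cT.measure_ne_top, measureReal_def, measureReal_def]

theorem measureReal_coneSlab_add {F A : Set W} (cF : IsCompact F) (cA : IsCompact A)
    {a b c : ℝ} (hab : a ≤ b) (hbc : b ≤ c) (ε : ℝ) :
    (volume.prod ν).real (coneSlab F A a c ε) =
      (volume.prod ν).real (coneSlab F A a b ε) + (volume.prod ν).real (coneSlab F A b c ε) := by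
  rw [← measureReal_union_of_height_le ν (isCompact_coneSlab cF cA _ _ _)
    (isCompact_coneSlab cF cA _ _ _) b (fun z hz => hz.1.2) (fun z hz => hz.1.1)]
  congr 1
  ext z
  simp only [coneSlab, mem_ofPred_eq, mem_union, mem_Icc]
  rcases le_total z.1 b with h | h <;> grind

theorem measureReal_reflect_coneSlab {F A : Set W} (cF : IsCompact F) (cA : IsCompact A)
    (k ε : ℝ) :
    (volume.prod ν).real {z : ℝ × W | z.1 ∈ Icc (0 : ℝ) 1 ∧ z.2 ∈ (k + 1 - z.1) • F + ε • A} =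
      (volume.prod ν).real (coneSlab F A k (k + 1) ε) := by
  have hmp : MeasurePreserving (Prod.map (fun h => k + 1 - h) id) (volume.prod ν)
      ((volume : Measure ℝ).prod ν) :=
    (Measure.measurePreserving_sub_left volume (k + 1)).prod (MeasurePreserving.id ν)
  rw [measureReal_def, measureReal_def, ← hmp.measure_preimage
    (isCompact_coneSlab cF cA _ _ _).measurableSet.nullMeasurableSet]
  congr 2
  ext ⟨t, y⟩
  simp only [coneSlab, mem_ofPred_eq, mem_preimage, mem_Icc, Prod.map, id]
  constructor <;> rintro ⟨⟨h1, h2⟩, h3⟩ <;> exact ⟨⟨by linarith, by linarith⟩, h3⟩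

omit [FiniteDimensional ℝ W] [MeasurableSpace W] [BorelSpace W] in
theorem slice_coneSlab {F A : Set W} {a b ε t : ℝ} (ht : t ∈ Icc a b) :
    Prod.mk t ⁻¹' coneSlab F A a b ε = t • F + ε • A := by
  ext y; simpa [coneSlab] using fun _ => ht

theorem le_measureReal_smul_add_smul {F A : Set W} (cF : IsCompact F) (nF : F.Nonempty)
    (cA : IsCompact A) (hAF : ν.real A = ν.real F) {t ε : ℝ} (ht : 0 ≤ t) (hε : 0 < ε) :
    (t + ε) ^ Module.finrank ℝ W * ν.real F ≤ ν.real (t • F + ε • A) := by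
  rcases ht.eq_or_lt with rfl | ht
  · rw [zero_smul_set nF, zero_add, zero_add, measureReal_smul ν hε.le, hAF]
  have hs : 0 < t + ε := by positivity
  have e : t • F + ε • A = (t + ε) • ((1 - ε / (t + ε)) • F + (ε / (t + ε)) • A) := by
    rw [smul_add, smul_smul, smul_smul]
    congr 2 <;> field_simp
    ring
  rw [e, measureReal_smul ν hs.le]
  refine mul_le_mul_of_nonneg_left ?_ (by positivity)
  have := measureReal_rpow_mul_le ν cF cA (s := ε / (t + ε)) (by positivity)
    (by rw [div_lt_one hs]; linarith)
  refine le_trans ?_ this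
  rcases measureReal_nonneg.eq_or_lt (a := (0 : ℝ)) (b := ν.real F) with h0 | h0
  · rw [← h0]
    exact mul_nonneg (Real.rpow_nonneg (by simp) _) (Real.rpow_nonneg (by simp [hAF, ← h0]) _)
  rw [hAF, ← Real.rpow_add h0]
  simp

theorem measureReal_pyramid {F : Set W} (cF : IsCompact F) :
    (volume.prod ν).real (pyramid F) = ν.real F / (Module.finrank ℝ W + 1) := by
  have e : ∫ t in (0 : ℝ)..1, t ^ Module.finrank ℝ W * ν.real F =
      ν.real F / (Module.finrank ℝ W + 1) := by
    rw [intervalIntegral.integral_mul_const, integral_pow]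
    simp; ring
  have hs (t : ℝ) (ht : t ∈ Icc (0 : ℝ) 1) :
      ν.real (Prod.mk t ⁻¹' pyramid F) = t ^ Module.finrank ℝ W * ν.real F := by
    rw [pyramid_eq_coneSlab, slice_coneSlab ht, ← measureReal_smul ν ht.1]
    simp
  rw [← e]
  refine le_antisymm ?_ ?_
  · exact measureReal_le_integral_of_slices ν (isCompact_pyramid cF) zero_le_one (by fun_prop)
      (fun z hz => hz.1) fun t ht => (hs t ht).le
  · exact integral_le_measureReal_of_slices ν (isCompact_pyramid cF) zero_le_one (by fun_prop)
      (fun t ht => mul_nonneg (pow_nonneg ht.1 _) measureReal_nonneg) fun t ht => (hs t ht).ge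

theorem le_measureReal_coneSlab {F A : Set W} (cF : IsCompact F) (nF : F.Nonempty)
    (cA : IsCompact A) (hAF : ν.real A = ν.real F) {ε : ℝ} (hε : 0 < ε) :
    ν.real F * ((1 + ε) ^ (Module.finrank ℝ W + 1) - ε ^ (Module.finrank ℝ W + 1)) /
      (Module.finrank ℝ W + 1) ≤ (volume.prod ν).real (coneSlab F A 0 1 ε) := by
  have e : ∫ t in (0 : ℝ)..1, (t + ε) ^ Module.finrank ℝ W * ν.real F =
      ν.real F * ((1 + ε) ^ (Module.finrank ℝ W + 1) - ε ^ (Module.finrank ℝ W + 1)) /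
      (Module.finrank ℝ W + 1) := by
    rw [intervalIntegral.integral_mul_const,
      intervalIntegral.integral_comp_add_right (fun t => t ^ Module.finrank ℝ W), integral_pow]
    rw [zero_add]; ring
  rw [← e]
  refine integral_le_measureReal_of_slices ν (isCompact_coneSlab cF cA _ _ _) zero_le_one
    (by fun_prop) (fun t ht => mul_nonneg (pow_nonneg (by linarith [ht.1]) _) measureReal_nonneg)
    fun t ht => ?_
  rw [slice_coneSlab ht]
  exact le_measureReal_smul_add_smul ν cF nF cA hAF ht.1 hε

end Cone

section Cap

variable {W : Type*} [NormedAddCommGroup W] [NormedSpace ℝ W]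

/-- The reflected cone slab: the slices shrink from `(k + 1) • F` to `k • F`. -/
def capSlab (F A : Set W) (k ε : ℝ) : Set (ℝ × W) :=
  {z | z.1 ∈ Icc (0 : ℝ) 1 ∧ z.2 ∈ (k + 1 - z.1) • F + ε • A}

theorem isCompact_capSlab {F A : Set W} (cF : IsCompact F) (cA : IsCompact A) (k ε : ℝ) :
    IsCompact (capSlab F A k ε) := by
  have e : capSlab F A k ε = (fun z : ℝ × W => (k + 1 - z.1, z.2)) '' coneSlab F A k (k + 1) ε := by
    ext ⟨t, y⟩
    constructor
    · rintro ⟨ht, h⟩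
      exact ⟨(k + 1 - t, y), ⟨⟨by linarith [ht.2], by linarith [ht.1]⟩, h⟩, by simp⟩
    · rintro ⟨⟨u, z⟩, ⟨hu, h⟩, h'⟩
      obtain ⟨rfl, rfl⟩ := Prod.ext_iff.1 h'
      refine ⟨⟨by linarith [hu.2], by linarith [hu.1]⟩, ?_⟩
      simpa using h
  rw [e]
  exact (isCompact_coneSlab cF cA _ _ _).image (by fun_prop)

variable {K : Set (ℝ × W)} {F A : Set W} (hK : Convex ℝ K) (hneg : ∀ z ∈ K, z.1 ≤ 0)
  (hF : ∀ y, y ∈ F ↔ ((0 : ℝ), y) ∈ K) (hC : ∀ z ∈ K, z.2 ∈ (1 - z.1) • F) (nK : K.Nonempty)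

include hK nK in
theorem mem_convexHull_insert_apex {z : ℝ × W} :
    z ∈ convexHull ℝ (insert ((1 : ℝ), (0 : W)) K) ↔
      ∃ a b : ℝ, 0 ≤ a ∧ 0 ≤ b ∧ a + b = 1 ∧ ∃ w ∈ K, (a + b * w.1, b • w.2) = z := by
  rw [convexHull_insert nK, hK.convexHull_eq, mem_convexJoin]
  constructor
  · rintro ⟨_, rfl, w, hw, a, b, ha, hb, hab, rfl⟩
    exact ⟨a, b, ha, hb, hab, w, hw, by simp [Prod.ext_iff]⟩
  · rintro ⟨a, b, ha, hb, hab, w, hw, rfl⟩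
    exact ⟨_, rfl, w, hw, a, b, ha, hb, hab, by simp [Prod.ext_iff]⟩

include hK nK hneg hF hC in
theorem mem_of_mem_convexHull_insert_apex {z : ℝ × W}
    (hz : z ∈ convexHull ℝ (insert ((1 : ℝ), (0 : W)) K)) (h0 : z.1 ≤ 0) : z ∈ K := by
  obtain ⟨a, b, ha, hb, hab, ⟨τ, y⟩, hw, rfl⟩ := (mem_convexHull_insert_apex hK nK).1 hz
  obtain ⟨f, hf, hfy⟩ := hC _ hw
  obtain rfl : (1 - τ) • f = y := hfy
  have hτ : τ ≤ 0 := hneg _ hw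
  simp only at h0
  rcases hτ.eq_or_lt with rfl | hτ
  · obtain rfl : a = 0 := by linarith
    obtain rfl : b = 1 := by linarith
    simpa using hw
  have hmem := hK ((hF f).1 hf) hw (a := 1 - (a + b * τ) / τ) (b := (a + b * τ) / τ) ?_
    (div_nonneg_of_nonpos h0 hτ.le) (by ring)
  · convert hmem using 1
    have h1 : (a + b * τ) / τ * τ = a + b * τ := by field_simp [hτ.ne]
    obtain rfl : a = 1 - b := by linarith
    ext
    · simp [h1]
    · simp only [Prod.smul_mk, Prod.mk_add_mk, smul_smul, ← add_smul]
      congr 1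
      linear_combination h1
  · have : (a + b * τ) / τ ≤ 1 := by
      rw [div_le_one_of_neg hτ]
      obtain rfl : b = 1 - a := by linarith
      nlinarith
    linarith

include hK nK hneg hC in
theorem snd_mem_of_mem_convexHull_insert_apex {z : ℝ × W}
    (hz : z ∈ convexHull ℝ (insert ((1 : ℝ), (0 : W)) K)) :
    z.1 ≤ 1 ∧ z.2 ∈ (1 - z.1) • F := by
  obtain ⟨a, b, ha, hb, hab, ⟨τ, y⟩, hw, rfl⟩ := (mem_convexHull_insert_apex hK nK).1 hz
  obtain ⟨f, hf, hfy⟩ := hC _ hw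
  obtain rfl : (1 - τ) • f = y := hfy
  have hτ : τ ≤ 0 := hneg _ hw
  obtain rfl : a = 1 - b := by linarith
  refine ⟨by simp only; nlinarith, ⟨f, hf, ?_⟩⟩
  simp only [smul_smul]
  congr 1
  ring

include hK nK hneg hF hC in
theorem convexHull_insert_apex_add {k ε : ℝ} (hk : 0 ≤ k) :
    convexHull ℝ (insert ((1 : ℝ), (0 : W)) K) + k • K + ε • (({0} : Set ℝ) ×ˢ A) =
      ((k + 1) • K + ε • (({0} : Set ℝ) ×ˢ A)) ∪ capSlab F A k ε := by
  have hFc : Convex ℝ F := by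
    intro x hx y hy a b ha hb hab
    rw [hF] at *
    simpa using hK hx hy ha hb hab
  refine Subset.antisymm ?_ (union_subset ?_ ?_)
  · rintro _ ⟨_, ⟨l, hl, _, ⟨κ, hκ, rfl⟩, rfl⟩, _, ⟨⟨u, a⟩, ⟨hu, ha⟩, rfl⟩, rfl⟩
    obtain rfl : u = 0 := hu
    rcases le_total (l.1 + k * κ.1) 0 with h | h
    · left
      refine add_mem_add ?_ (smul_mem_smul_set ⟨rfl, ha⟩)
      have hk1 : 0 < k + 1 := by linarith
      refine ⟨(k + 1)⁻¹ • (l + k • κ), ?_, ?_⟩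
      · refine mem_of_mem_convexHull_insert_apex hK hneg hF hC nK ?_ ?_
        · rw [smul_add, smul_smul]
          refine convex_convexHull ℝ _ hl (subset_convexHull ℝ _ (mem_insert_of_mem _ hκ))
            (by positivity) (by positivity) ?_
          field_simp; ring
        · exact mul_nonpos_of_nonneg_of_nonpos (by positivity) h
      · simp [smul_smul, hk1.ne']
    · right
      obtain ⟨hl1, hl2⟩ := snd_mem_of_mem_convexHull_insert_apex hK hneg hC nK hl
      have hκ1 := hneg _ hκ
      refine ⟨⟨by simpa using h, ?_⟩, ?_⟩
      · have : k * κ.1 ≤ 0 := mul_nonpos_of_nonneg_of_nonpos hk hκ1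
        simp only [Prod.fst_add, Prod.smul_fst, smul_eq_mul, mul_zero, add_zero]
        linarith
      · simp only [Prod.fst_add, Prod.smul_fst, smul_eq_mul, mul_zero, add_zero, Prod.snd_add,
          Prod.smul_snd]
        refine add_mem_add ?_ (smul_mem_smul_set ha)
        have : k + 1 - (l.1 + k * κ.1) = (1 - l.1) + k * (1 - κ.1) := by ring
        rw [this, hFc.add_smul (by linarith) (mul_nonneg hk (by linarith)), mul_smul]
        exact add_mem_add hl2 (smul_mem_smul_set (hC _ hκ))
  · rw [add_comm k 1, hK.add_smul zero_le_one hk, one_smul]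
    exact add_subset_add_right (add_subset_add_right
      ((subset_insert _ _).trans (subset_convexHull ℝ _)))
  · rintro ⟨t, y⟩ ⟨ht, _, ⟨f, hf, rfl⟩, _, ⟨a, ha, rfl⟩, h⟩
    simp only at ht h
    subst h
    have hl : (t, (1 - t) • f) ∈ convexHull ℝ (insert ((1 : ℝ), (0 : W)) K) :=
      (mem_convexHull_insert_apex hK nK).2 ⟨t, 1 - t, ht.1, by linarith [ht.2], by ring, (0, f),
        (hF f).1 hf, by simp⟩
    refine ⟨_, add_mem_add hl (smul_mem_smul_set ((hF f).1 hf)), _,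
      smul_mem_smul_set (show ((0 : ℝ), a) ∈ ({0} : Set ℝ) ×ˢ A from ⟨rfl, ha⟩), ?_⟩
    simp only [Prod.smul_mk, Prod.mk_add_mk, smul_eq_mul, mul_zero, add_zero, ← add_smul]
    congr 3
    ring

variable [FiniteDimensional ℝ W] [MeasurableSpace W] [BorelSpace W] (ν : Measure W)
    [ν.IsAddHaarMeasure]

include hK nK hneg hF hC in
theorem measureReal_convexHull_insert_apex_add (cK : IsCompact K) (cA : IsCompact A) {k ε : ℝ}
    (hk : 0 ≤ k) :
    (volume.prod ν).real (convexHull ℝ (insert ((1 : ℝ), (0 : W)) K) + k • K +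
        ε • (({0} : Set ℝ) ×ˢ A)) =
      (volume.prod ν).real ((k + 1) • K + ε • (({0} : Set ℝ) ×ˢ A)) +
      ((volume.prod ν).real ((k + 1) • pyramid F + ε • (({0} : Set ℝ) ×ˢ A)) -
        (volume.prod ν).real (k • pyramid F + ε • (({0} : Set ℝ) ×ˢ A))) := by
  have cF : IsCompact F := by
    have : F = Prod.snd '' (K ∩ {z | z.1 = 0}) := by
      ext y
      rw [hF]
      constructor
      · exact fun h => ⟨(0, y), ⟨h, rfl⟩, rfl⟩
      · rintro ⟨⟨t, y⟩, ⟨h, h'⟩, rfl⟩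
        obtain rfl : t = 0 := h'
        exact h
    rw [this]
    exact (cK.inter_right (isClosed_eq continuous_fst continuous_const)).image continuous_snd
  rw [convexHull_insert_apex_add hK hneg hF hC nK hk, smul_pyramid_add hk,
    smul_pyramid_add (by linarith), measureReal_coneSlab_add ν cF cA hk (by linarith : k ≤ k + 1),
    measureReal_union_of_height_le ν ((cK.smul _).add ((isCompact_singleton.prod cA).smul _))
      (isCompact_capSlab cF cA _ _) 0 ?_ (fun z hz => hz.1.1), add_sub_cancel_left,
    capSlab, measureReal_reflect_coneSlab ν cF cA]
  rintro _ ⟨_, ⟨κ, hκ, rfl⟩, _, ⟨⟨u, a⟩, ⟨hu, ha⟩, rfl⟩, rfl⟩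
  obtain rfl : u = 0 := hu
  simpa using mul_nonpos_of_nonneg_of_nonpos (by linarith) (hneg _ hκ)

end Cap

section Polarization

/-- The `N`-th forward difference at `0`. -/
noncomputable def altSum (N : ℕ) (g : ℕ → ℝ) : ℝ :=
  ∑ k ∈ Finset.range (N + 1), (-1 : ℝ) ^ (N - k) * N.choose k * g k

theorem altSum_eq_fwdDiff (N : ℕ) (g : ℝ → ℝ) :
    altSum N (fun k => g k) = (fwdDiff 1)^[N] g 0 := by
  rw [fwdDiff_iter_eq_sum_shift, altSum]
  refine Finset.sum_congr rfl fun k _ => ?_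
  simp [zsmul_eq_mul]

theorem altSum_mul_const (N : ℕ) (g : ℕ → ℝ) (c : ℝ) :
    altSum N (fun k => g k * c) = altSum N g * c := by
  simp only [altSum, Finset.sum_mul, mul_assoc]

theorem altSum_second_difference_pow (N : ℕ) :
    altSum N (fun k => ((k : ℝ) + 2) ^ (N + 2) - 2 * ((k : ℝ) + 1) ^ (N + 2) + (k : ℝ) ^ (N + 2)) =
      (N + 2).factorial := by
  rw [altSum_eq_fwdDiff N (fun x => (x + 2) ^ (N + 2) - 2 * (x + 1) ^ (N + 2) + x ^ (N + 2))]
  have := congrFun (fwdDiff_iter_eq_factorial (R := ℝ) (n := N + 2)) 0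
  rw [Function.iterate_add_apply] at this
  rw [Pi.natCast_apply] at this
  rw [← this]
  refine congrArg (fun g => (fwdDiff 1)^[N] g 0) (funext fun x => ?_)
  simp only [Function.iterate_succ, Function.iterate_zero, Function.comp, id, fwdDiff]
  ring

theorem altSum_difference_pow (N : ℕ) :
    altSum N (fun k => ((k : ℝ) + 1) ^ (N + 1) - (k : ℝ) ^ (N + 1)) = (N + 1).factorial := by
  rw [altSum_eq_fwdDiff N (fun x => (x + 1) ^ (N + 1) - x ^ (N + 1))]
  have := congrFun (fwdDiff_iter_eq_factorial (R := ℝ) (n := N + 1)) 0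
  rw [Function.iterate_add_apply, Pi.natCast_apply] at this
  rw [← this]
  rfl

theorem tendsto_altSum (N : ℕ) {ι : Type*} {l : Filter ι} {g : ι → ℕ → ℝ} {h : ℕ → ℝ}
    (H : ∀ k, Tendsto (fun i => g i k) l (𝓝 (h k))) :
    Tendsto (fun i => altSum N (g i)) l (𝓝 (altSum N h)) :=
  tendsto_finsetSum _ fun k _ => (H k).const_mul _

/-- The polarized volume: `(N + 2)!` times the mixed volume of `A`, `B` and `N` copies
of the convex set `K`. -/
noncomputable def polarSum {E : Type*} [AddCommGroup E] [Module ℝ E] [MeasurableSpace E]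
    (μ : Measure E) (N : ℕ) (K A B : Set E) : ℝ :=
  altSum N fun k => μ.real (A + B + (k : ℝ) • K) - μ.real (A + (k : ℝ) • K) -
    μ.real (B + (k : ℝ) • K) + μ.real ((k : ℝ) • K)

theorem Convex.nsmul_eq_smul {E : Type*} [AddCommGroup E] [Module ℝ E] {K : Set E}
    (hK : Convex ℝ K) (nK : K.Nonempty) (k : ℕ) : k • K = (k : ℝ) • K := by
  induction k with
  | zero => rw [zero_smul, Nat.cast_zero, zero_smul_set nK]
  | succ k ih =>
    rw [succ_nsmul, ih, Nat.cast_succ, hK.add_smul (by positivity) zero_le_one, one_smul]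

theorem factorial_mul_mixedVol (N : ℕ) {K A B : Set (EuclideanSpace ℝ (Fin (N + 2)))}
    (hK : Convex ℝ K) (nK : K.Nonempty) :
    ((N + 2).factorial : ℝ) * mixedVol (N + 2)
      (fun j => if (j : ℕ) = 0 then A else if (j : ℕ) = 1 then B else K) =
      polarSum volume N K A B := by
  classical
  set f : Fin (N + 2) → Set (EuclideanSpace ℝ (Fin (N + 2))) :=
    fun j => if (j : ℕ) = 0 then A else if (j : ℕ) = 1 then B else K with hf
  have f0 : f 0 = A := by simp [hf]
  have f1 : f 1 = B := by simp [hf]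
  set R : Finset (Fin (N + 2)) := Finset.univ \ {0, 1} with hR
  have h0 : (0 : Fin (N + 2)) ∉ insert 1 R := by simp [hR]
  have h1 : (1 : Fin (N + 2)) ∉ R := by simp [hR]
  have hu : (Finset.univ : Finset (Fin (N + 2))) = insert 0 (insert 1 R) := by
    ext x; simp only [hR]; simp; tauto
  have hc : R.card = N := by
    have := congrArg Finset.card hu
    rw [Finset.card_insert_of_notMem h0, Finset.card_insert_of_notMem h1] at this
    simpa using this.symm
  have hs (S : Finset (Fin (N + 2))) (hS : S ∈ R.powerset) : ∑ i ∈ S, f i = (S.card : ℝ) • K := by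
    rw [← hK.nsmul_eq_smul nK, ← Finset.sum_const]
    refine Finset.sum_congr rfl fun i hi => ?_
    have := Finset.mem_powerset.1 hS hi
    simp only [hR, Finset.mem_sdiff, Finset.mem_univ, true_and, Finset.mem_insert,
      Finset.mem_singleton, not_or, Fin.ext_iff] at this
    simp only [hf]
    rw [if_neg (by simpa using this.1), if_neg (by simpa using this.2)]
  rw [mixedVol, ← mul_assoc, mul_inv_cancel₀ (by positivity), one_mul]
  rw [show (Finset.univ : Finset (Finset (Fin (N + 2)))) =
    (Finset.univ : Finset (Fin (N + 2))).powerset by simp, hu, Finset.sum_powerset_insert h0,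
    Finset.sum_powerset_insert h1, Finset.sum_powerset_insert h1, ← Finset.sum_add_distrib,
    ← Finset.sum_add_distrib, ← Finset.sum_add_distrib, polarSum, altSum]
  rw [show N + 1 = R.card + 1 by rw [hc]]
  have key := Finset.sum_powerset_apply_card (x := R) (fun k => (-1 : ℝ) ^ (N - k) *
    (volume.real (A + B + (k : ℝ) • K) - volume.real (A + (k : ℝ) • K) -
    volume.real (B + (k : ℝ) • K) + volume.real ((k : ℝ) • K)))
  rw [hc] at key ⊢
  simp only [nsmul_eq_mul] at key
  trans ∑ k ∈ Finset.range (N + 1), (N.choose k : ℝ) * ((-1 : ℝ) ^ (N - k) *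
    (volume.real (A + B + (k : ℝ) • K) - volume.real (A + (k : ℝ) • K) -
    volume.real (B + (k : ℝ) • K) + volume.real ((k : ℝ) • K)))
  · rw [← key]
    refine Finset.sum_congr rfl fun S hS => ?_
    have hSR := Finset.mem_powerset.1 hS
    have c1 : 1 ∉ S := fun h => h1 (hSR h)
    have c0 : 0 ∉ insert 1 S := fun h => h0 (Finset.insert_subset_insert _ hSR h)
    have c0' : 0 ∉ S := fun h => c0 (Finset.mem_insert_of_mem h)
    have hle : S.card ≤ N := (Finset.card_le_card hSR).trans hc.le
    rw [Finset.card_insert_of_notMem c0, Finset.card_insert_of_notMem c1,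
      Finset.card_insert_of_notMem c0', Finset.sum_insert c0, Finset.sum_insert c1,
      Finset.sum_insert c0', hs S hS, f0, f1, ← add_assoc A B]
    obtain ⟨d, hd⟩ := Nat.exists_eq_add_of_le hle
    rw [show N + 2 - S.card = d + 2 by omega, show N + 2 - (S.card + 1) = d + 1 by omega,
      show N + 2 - (S.card + 1 + 1) = d by omega, show N - S.card = d by omega]
    simp only [measureReal_def]
    ring
  · exact Finset.sum_congr rfl fun k _ => by ring

end Polarization

section SlopeInequality

variable {E : Type*} [NormedAddCommGroup E] [NormedSpace ℝ E]
    [FiniteDimensional ℝ E] [MeasurableSpace E] [BorelSpace E] (μ : Measure E)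
    [μ.IsAddHaarMeasure] {N : ℕ} (hN : Module.finrank ℝ E = N + 2)

include hN in
theorem tendsto_slope_smul_add {X A : Set E} (nX : X.Nonempty) (hA0 : μ.real A = 0) {D : ℝ}
    (hD : Tendsto (fun ε : ℝ => (μ.real (X + ε • A) - μ.real X) / ε) (𝓝[>] 0) (𝓝 D)) (k : ℕ) :
    Tendsto (fun ε : ℝ => (μ.real ((k : ℝ) • X + ε • A) - μ.real ((k : ℝ) • X)) / ε) (𝓝[>] 0)
      (𝓝 ((k : ℝ) ^ (N + 1) * D)) := by
  rcases k.eq_zero_or_pos with rfl | hk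
  · have h0 : μ.real (0 : Set E) = 0 := by
      have := measureReal_smul μ le_rfl X
      rwa [hN, zero_smul_set nX, zero_pow (by omega), zero_mul] at this
    simp only [Nat.cast_zero, zero_smul_set nX, zero_add, ne_eq, Nat.add_eq_zero_iff, one_ne_zero,
      and_false, not_false_eq_true, zero_pow, zero_mul, h0, sub_zero]
    refine tendsto_const_nhds.congr' ?_
    filter_upwards [self_mem_nhdsWithin] with ε hε
    rw [measureReal_smul μ (le_of_lt hε), hA0, mul_zero, zero_div]
  have hk' : (0 : ℝ) < k := by exact_mod_cast hk
  have hlim : Tendsto (fun ε : ℝ => ε / k) (𝓝[>] 0) (𝓝[>] 0) := by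
    refine tendsto_nhdsWithin_iff.2 ⟨?_, ?_⟩
    · refine Tendsto.mono_left ?_ nhdsWithin_le_nhds
      simpa using (continuous_id.div_const (k : ℝ)).tendsto (0 : ℝ)
    · filter_upwards [self_mem_nhdsWithin] with ε hε
      exact div_pos hε hk'
  refine ((hD.comp hlim).const_mul ((k : ℝ) ^ (N + 1))).congr fun ε => ?_
  have e : (k : ℝ) • X + ε • A = (k : ℝ) • (X + (ε / k) • A) := by
    rw [smul_add, smul_smul, mul_div_cancel₀ _ hk'.ne']
  rw [e, measureReal_smul μ hk'.le, measureReal_smul μ hk'.le, hN]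
  simp only [Function.comp]
  rcases eq_or_ne ε 0 with rfl | hε
  · simp
  field_simp
  ring

variable {K : Set E} (hK : Convex ℝ K) (nK : K.Nonempty)

include hK in
omit [FiniteDimensional ℝ E] [MeasurableSpace E] [BorelSpace E] in
theorem add_smul_of_convex (k : ℕ) : K + (k : ℝ) • K = ((k : ℝ) + 1) • K := by
  rw [add_comm (k : ℝ) 1, hK.add_smul zero_le_one (by positivity), one_smul]

include hN hK in
theorem polarSum_self : polarSum μ N K K K = (N + 2).factorial * μ.real K := by
  rw [← altSum_second_difference_pow, ← altSum_mul_const, polarSum]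
  congr 1
  ext k
  rw [add_assoc, add_smul_of_convex hK]
  have := add_smul_of_convex hK (k + 1)
  push_cast at this
  rw [this, measureReal_smul μ (by positivity), measureReal_smul μ (by positivity),
    measureReal_smul μ (by positivity), hN]
  ring

variable {P L A : Set E}
  (hL : ∀ k ε : ℝ, 0 ≤ k → μ.real (L + k • K + ε • A) =
    μ.real ((k + 1) • K + ε • A) + (μ.real ((k + 1) • P + ε • A) - μ.real (k • P + ε • A)))

include hN hK hL in
theorem polarSum_apex (nA : A.Nonempty) :
    polarSum μ N K L K = (N + 2).factorial * (μ.real K + μ.real P) := by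
  rw [← altSum_second_difference_pow, ← altSum_mul_const, polarSum]
  congr 1
  ext k
  have h (k : ℝ) (hk : 0 ≤ k) : μ.real (L + k • K) =
      (k + 1) ^ (N + 2) * μ.real K + ((k + 1) ^ (N + 2) - k ^ (N + 2)) * μ.real P := by
    have := hL k 0 hk
    rw [add_zero_smul nA, add_zero_smul nA, add_zero_smul nA, add_zero_smul nA] at this
    rw [this, measureReal_smul μ (by positivity), measureReal_smul μ (by positivity),
      measureReal_smul μ hk, hN]
    ring
  rw [add_assoc, add_smul_of_convex hK, h _ (by positivity), h _ (by positivity),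
    measureReal_smul μ (by positivity), measureReal_smul μ (by positivity), hN]
  ring

include hN hK nK in
theorem tendsto_polarSum_smul (hA0 : μ.real A = 0) {D : ℝ}
    (hD : Tendsto (fun ε : ℝ => (μ.real (K + ε • A) - μ.real K) / ε) (𝓝[>] 0) (𝓝 D)) :
    Tendsto (fun ε : ℝ => polarSum μ N K (ε • A) K / ε) (𝓝[>] 0)
      (𝓝 ((N + 1).factorial * D)) := by
  rw [← altSum_difference_pow, ← altSum_mul_const]
  simp only [polarSum, div_eq_mul_inv, ← altSum_mul_const]
  refine tendsto_altSum N fun k => ?_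
  have h1 := tendsto_slope_smul_add μ hN nK hA0 hD (k + 1)
  have h0 := tendsto_slope_smul_add μ hN nK hA0 hD k
  rw [sub_mul]
  push_cast at h1
  refine (h1.sub h0).congr fun ε => ?_
  rw [add_assoc, add_smul_of_convex hK, add_comm (ε • A), add_comm (ε • A)]
  ring

include hN hL nK in
theorem tendsto_polarSum_apex_smul (nP : P.Nonempty) (nA : A.Nonempty)
    (hA0 : μ.real A = 0) {D D' : ℝ}
    (hD : Tendsto (fun ε : ℝ => (μ.real (K + ε • A) - μ.real K) / ε) (𝓝[>] 0) (𝓝 D))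
    (hD' : Tendsto (fun ε : ℝ => (μ.real (P + ε • A) - μ.real P) / ε) (𝓝[>] 0) (𝓝 D')) :
    Tendsto (fun ε : ℝ => polarSum μ N K L (ε • A) / ε) (𝓝[>] 0)
      (𝓝 ((N + 1).factorial * (D + D'))) := by
  rw [← altSum_difference_pow, ← altSum_mul_const]
  simp only [polarSum, div_eq_mul_inv, ← altSum_mul_const]
  refine tendsto_altSum N fun k => ?_
  have h1 := tendsto_slope_smul_add μ hN nK hA0 hD (k + 1)
  have h0 := tendsto_slope_smul_add μ hN nK hA0 hD k
  have h1' := tendsto_slope_smul_add μ hN nP hA0 hD' (k + 1)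
  have h0' := tendsto_slope_smul_add μ hN nP hA0 hD' k
  rw [sub_mul, mul_add, mul_add, add_sub_add_comm]
  push_cast at h1 h1'
  refine ((h1.sub h0).add (h1'.sub h0')).congr fun ε => ?_
  have e := hL k 0 (by positivity)
  rw [add_zero_smul nA, add_zero_smul nA, add_zero_smul nA, add_zero_smul nA] at e
  rw [add_right_comm, hL k ε (by positivity), e, add_comm (ε • A)]
  ring

include hN hK nK hL in
/-- Letting the second body shrink to a point in the Bezout inequality. -/
theorem slope_mul_le (cA : IsCompact A) (hA : Convex ℝ A)
    (nA : A.Nonempty) (hA0 : μ.real A = 0) (nP : P.Nonempty)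
    (hB : ∀ B : Set E, Convex ℝ B → IsCompact B → B.Nonempty →
      polarSum μ N K L B * polarSum μ N K K K ≤ polarSum μ N K L K * polarSum μ N K B K)
    {D D' : ℝ}
    (hD : Tendsto (fun ε : ℝ => (μ.real (K + ε • A) - μ.real K) / ε) (𝓝[>] 0) (𝓝 D))
    (hD' : Tendsto (fun ε : ℝ => (μ.real (P + ε • A) - μ.real P) / ε) (𝓝[>] 0) (𝓝 D')) :
    D' * μ.real K ≤ D * μ.real P := by
  have h1 := tendsto_polarSum_apex_smul μ hN nK hL nP nA hA0 hD hD'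
  have h2 := tendsto_polarSum_smul μ hN hK nK hA0 hD
  have h := le_of_tendsto_of_tendsto (h1.mul_const (polarSum μ N K K K))
    (h2.const_mul (polarSum μ N K L K)) ?_
  · rw [polarSum_self μ hN hK, polarSum_apex μ hN hK hL nA] at h
    have p1 : (0 : ℝ) < (N + 1).factorial := by positivity
    have p2 : (0 : ℝ) < (N + 2).factorial := by positivity
    have : ((N + 1).factorial * (N + 2).factorial : ℝ) * (D' * μ.real K) ≤
      ((N + 1).factorial * (N + 2).factorial : ℝ) * (D * μ.real P) := by linarith
    exact le_of_mul_le_mul_left this (by positivity)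
  · filter_upwards [self_mem_nhdsWithin] with ε hε
    have hε : 0 < ε := hε
    have := hB (ε • A) (hA.smul ε) (cA.smul ε) nA.smul_set
    rw [div_mul_eq_mul_div, mul_div_assoc']
    gcongr

end SlopeInequality

theorem measureReal_add_singleton {E : Type*} [AddGroup E] [MeasurableSpace E] [MeasurableAdd E]
    (μ : Measure E) [μ.IsAddRightInvariant] (S : Set E) (y : E) :
    μ.real (S + {y}) = μ.real S := by
  rw [add_singleton, image_add_right, measureReal_def, measure_preimage_add_right,
    ← measureReal_def]

theorem integral_one_add_mul_pow (m : ℕ) (T : ℝ) {s : ℝ} (hs : s ≠ 0) :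
    ∫ u in (-T)..0, (1 + s * u) ^ m = (1 - (1 - s * T) ^ (m + 1)) / (s * (m + 1)) := by
  rw [intervalIntegral.integral_comp_add_mul (fun x => x ^ m) hs, integral_pow]
  simp only [mul_zero, add_zero, one_pow, smul_eq_mul, mul_neg, ← sub_eq_add_neg]
  field_simp

theorem tendsto_one_add_mul_pow_slope (n : ℕ) (c V b : ℝ) :
    Tendsto (fun ε : ℝ => ((1 + c * ε) ^ n * V - c * ε * b - V) / ε) (𝓝[>] 0)
      (𝓝 (c * (n * V - b))) := by
  have h1 : HasDerivAt (fun ε : ℝ => 1 + c * ε) c 0 := by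
    simpa using ((hasDerivAt_id (0 : ℝ)).const_mul c).const_add 1
  have h2 : HasDerivAt (fun ε : ℝ => c * ε * b) (c * b) 0 := by
    simpa using ((hasDerivAt_id (0 : ℝ)).const_mul c).mul_const b
  have h := (((h1.pow n).mul_const V).sub h2).tendsto_slope_zero_right
  have e : (n : ℝ) * (1 + c * 0) ^ (n - 1) * c * V - c * b = c * (n * V - b) := by
    simp; ring
  rw [e] at h
  refine h.congr fun ε => ?_
  simp [div_eq_inv_mul]

section Height

variable {W : Type*} [NormedAddCommGroup W] [NormedSpace ℝ W]
    [FiniteDimensional ℝ W] [MeasurableSpace W] [BorelSpace W] (ν : Measure W)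
    [ν.IsAddHaarMeasure] {K : Set (ℝ × W)} {F : Set W} {T : ℝ} {q : W}
    (hK : Convex ℝ K) (cK : IsCompact K) (hF : ∀ y ∈ F, ((0 : ℝ), y) ∈ K)
    (hT : 0 < T) (hq : (-T, q) ∈ K)

include hK cK hF hT hq in
theorem le_measureReal_slice_smul {M r : ℝ} (hM : 0 < M) (hr : 0 ≤ r) (hrM : r ≤ M * T) :
    (M - r / T) ^ Module.finrank ℝ W * ν.real F ≤ ν.real (Prod.mk (-r) ⁻¹' (M • K)) := by
  have hrT : r / T ≤ M := by rwa [div_le_iff₀ hT]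
  rw [← measureReal_smul ν (by linarith), ← measureReal_add_singleton ν _ ((r / T) • q)]
  refine measureReal_mono ?_ (measure_slice_ne_top ν (cK.smul M) _)
  rintro _ ⟨_, ⟨f, hf, rfl⟩, _, rfl, rfl⟩
  refine ⟨(1 - r / T / M) • ((0 : ℝ), f) + (r / T / M) • (-T, q), hK (hF f hf) hq ?_
    (by positivity) (by ring), ?_⟩
  · rw [sub_nonneg, div_le_one hM]; exact hrT
  · ext
    · simp; field_simp
    · simp only [Prod.smul_mk, Prod.mk_add_mk, smul_add, smul_smul]
      congr 2 <;> field_simp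

include hK cK hF hT hq in
theorem le_measureReal_of_apex :
    ν.real F * T / (Module.finrank ℝ W + 1) ≤ (volume.prod ν).real K := by
  have h : ∫ u in (-T)..0, (1 + T⁻¹ * u) ^ Module.finrank ℝ W * ν.real F =
      ν.real F * T / (Module.finrank ℝ W + 1) := by
    rw [intervalIntegral.integral_mul_const, integral_one_add_mul_pow _ _ (by positivity),
      inv_mul_cancel₀ hT.ne']
    simp; field_simp
  rw [← h]
  have hu (u : ℝ) (hu : u ∈ Icc (-T) 0) : 0 ≤ 1 + T⁻¹ * u := by
    have : T⁻¹ * (-T) ≤ T⁻¹ * u := by gcongr; exact hu.1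
    have : T⁻¹ * T = 1 := by field_simp
    linarith
  refine integral_le_measureReal_of_slices ν cK (by linarith) (by fun_prop)
    (fun u h => mul_nonneg (pow_nonneg (hu u h) _) measureReal_nonneg) fun u h => ?_
  have := le_measureReal_slice_smul ν hK cK hF hT hq one_pos (r := -u) (by linarith [h.2])
    (by linarith [h.1])
  rw [one_smul, neg_neg] at this
  convert this using 3
  ring

include hK cK hF hT hq in
theorem measureReal_add_slice_le (hneg : ∀ z ∈ K, z.1 ≤ 0) {t δ : ℝ} (ht : 0 < t) (htT : t ≤ T)
    (hδ : 0 ≤ δ) :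
    (volume.prod ν).real (K + δ • (({0} : Set ℝ) ×ˢ (Prod.mk (-t) ⁻¹' K))) ≤
      (1 + δ) ^ (Module.finrank ℝ W + 1) * (volume.prod ν).real K - δ * (t * ν.real F) := by
  set X := (1 + δ) • K with hX
  have cX : IsCompact X := cK.smul _
  have cS : IsCompact (X ∩ {z | z.1 ≤ -(δ * t)}) :=
    cX.inter_right (isClosed_le continuous_fst continuous_const)
  have cS' : IsCompact (X ∩ {z | -(δ * t) ≤ z.1}) :=
    cX.inter_right (isClosed_le continuous_const continuous_fst)
  have h1 : (volume.prod ν).real (K + δ • (({0} : Set ℝ) ×ˢ (Prod.mk (-t) ⁻¹' K))) ≤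
      (volume.prod ν).real (X ∩ {z | z.1 ≤ -(δ * t)}) := by
    rw [← measureReal_add_singleton _ _ (-(δ * t), (0 : W))]
    refine measureReal_mono ?_ cS.measure_ne_top
    rintro _ ⟨_, ⟨κ, hκ, _, ⟨⟨u, y⟩, ⟨hu, hy⟩, rfl⟩, rfl⟩, _, rfl, rfl⟩
    obtain rfl : u = 0 := hu
    refine ⟨?_, ?_⟩
    · rw [hX, hK.add_smul zero_le_one hδ, one_smul]
      refine ⟨κ, hκ, δ • (-t, y), smul_mem_smul_set hy, ?_⟩
      simp [Prod.ext_iff]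
    · simpa using hneg κ hκ
  have h2 : δ * (t * ν.real F) ≤ (volume.prod ν).real (X ∩ {z | -(δ * t) ≤ z.1}) := by
    have e : ∫ _ in (-(δ * t))..0, ν.real F = δ * (t * ν.real F) := by
      rw [intervalIntegral.integral_const, smul_eq_mul]; ring
    rw [← e]
    have hδt : 0 ≤ δ * t := by positivity
    refine integral_le_measureReal_of_slices ν cS' (by linarith) (by fun_prop)
      (fun u h => measureReal_nonneg) fun u h => ?_
    have hs : Prod.mk u ⁻¹' (X ∩ {z : ℝ × W | -(δ * t) ≤ z.1}) = Prod.mk u ⁻¹' X := by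
      ext y; simpa using fun _ => h.1
    have hu1 : -u ≤ δ * T := by
      have : δ * t ≤ δ * T := by gcongr
      linarith [h.1]
    have hu2 : -u / T ≤ δ := by rwa [div_le_iff₀ hT]
    have := le_measureReal_slice_smul ν hK cK hF hT hq (M := 1 + δ) (by linarith) (r := -u)
      (by linarith [h.2]) (by linarith)
    rw [neg_neg] at this
    rw [hs]
    refine le_trans ?_ this
    exact le_mul_of_one_le_left measureReal_nonneg (one_le_pow₀ (by linarith))
  have h3 := measureReal_union_of_height_le ν cS cS' (-(δ * t)) (fun z hz => hz.2)
    (fun z hz => hz.2)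
  have h4 : (volume.prod ν).real (X ∩ {z | z.1 ≤ -(δ * t)} ∪ X ∩ {z | -(δ * t) ≤ z.1}) ≤
      (volume.prod ν).real X :=
    measureReal_mono (union_subset inter_subset_left inter_subset_left) cX.measure_ne_top
  rw [hX, measureReal_smul _ (by linarith), finrank_real_prod] at h4
  linarith

include hK cK hF hT hq in
theorem slope_le_of_slice (hneg : ∀ z ∈ K, z.1 ≤ 0) {t c : ℝ} (ht : 0 < t) (htT : t ≤ T)
    (hc : 0 ≤ c) {D : ℝ}
    (hD : Tendsto (fun ε : ℝ => ((volume.prod ν).real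
      (K + ε • (({0} : Set ℝ) ×ˢ (c • (Prod.mk (-t) ⁻¹' K)))) - (volume.prod ν).real K) / ε)
      (𝓝[>] 0) (𝓝 D)) :
    D ≤ c * ((Module.finrank ℝ W + 1) * (volume.prod ν).real K - t * ν.real F) := by
  have h := tendsto_one_add_mul_pow_slope (Module.finrank ℝ W + 1) c ((volume.prod ν).real K)
    (t * ν.real F)
  push_cast at h
  refine le_of_tendsto_of_tendsto hD h ?_
  filter_upwards [self_mem_nhdsWithin] with ε hε
  have hε : 0 < ε := hε
  have e : ε • (({0} : Set ℝ) ×ˢ (c • (Prod.mk (-t) ⁻¹' K))) =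
      (c * ε) • (({0} : Set ℝ) ×ˢ (Prod.mk (-t) ⁻¹' K)) := by
    rw [smul_set_prod, smul_set_prod, smul_smul, mul_comm]
    simp
  have := measureReal_add_slice_le ν hK cK hF hT hq hneg ht htT (mul_nonneg hc hε.le)
  rw [e]
  gcongr

end Height

theorem IsCompact.convexHull_insert_of_convex {E : Type*} [NormedAddCommGroup E] [NormedSpace ℝ E]
    {K : Set E} (cK : IsCompact K) (hK : Convex ℝ K) (nK : K.Nonempty) (x : E) :
    IsCompact (convexHull ℝ (insert x K)) := by
  have h : convexHull ℝ (insert x K) =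
      (fun z : ℝ × E => (1 - z.1) • x + z.1 • z.2) '' (Icc 0 1 ×ˢ K) := by
    rw [convexHull_insert nK, hK.convexHull_eq]
    ext y
    rw [mem_convexJoin]
    constructor
    · rintro ⟨_, rfl, w, hw, a, b, ha, hb, hab, rfl⟩
      refine ⟨(b, w), ⟨⟨hb, by linarith⟩, hw⟩, ?_⟩
      simp [← hab]
    · rintro ⟨⟨b, w⟩, ⟨hb, hw⟩, rfl⟩
      exact ⟨x, rfl, w, hw, 1 - b, b, by linarith [hb.2], hb.1, by ring, rfl⟩
  rw [h]
  exact (isCompact_Icc.prod cK).image (by fun_prop)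

theorem Convex.subset_of_measureReal_le {E : Type*} [NormedAddCommGroup E] [NormedSpace ℝ E]
    [MeasurableSpace E] [BorelSpace E] (μ : Measure E) [μ.IsOpenPosMeasure]
    [IsFiniteMeasureOnCompacts μ] {K Q : Set E} (hK : Convex ℝ K) (cK : IsCompact K)
    (iK : (interior K).Nonempty) (cQ : IsCompact Q) (hQK : Q ⊆ K) (h : μ.real K ≤ μ.real Q) :
    K ⊆ Q := by
  have h0 : μ (K \ Q) = 0 := by
    have := measureReal_sdiff (μ := μ) hQK cQ.measurableSet cK.measure_ne_top
    have h1 : μ.real (K \ Q) = 0 :=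
      le_antisymm (by linarith) measureReal_nonneg
    exact (measureReal_eq_zero_iff
      (ne_top_of_le_ne_top cK.measure_ne_top (measure_mono sdiff_subset))).1 h1
  have ho : interior K \ Q = ∅ := by
    refine (isOpen_interior.sdiff cQ.isClosed).eq_empty_of_measure_zero (μ := μ)
      (measure_mono_null (sdiff_subset_sdiff_left interior_subset) h0)
  calc K ⊆ closure (interior K) := by
        rw [hK.closure_interior_eq_closure_of_nonempty_interior iK]; exact subset_closure
    _ ⊆ Q := closure_minimal (sdiff_eq_empty.1 ho) cQ.isClosed

section Main

variable {W : Type*} [NormedAddCommGroup W] [NormedSpace ℝ W]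
    [FiniteDimensional ℝ W] [MeasurableSpace W] [BorelSpace W] (ν : Measure W)
    [ν.IsAddHaarMeasure] {K : Set (ℝ × W)} {F : Set W}
    (hK : Convex ℝ K) (cK : IsCompact K) (iK : (interior K).Nonempty)
    (hneg : ∀ z ∈ K, z.1 ≤ 0)
    (hF : ∀ y, y ∈ F ↔ ((0 : ℝ), y) ∈ K) (iF : (interior F).Nonempty)
    (hC : ∀ z ∈ K, z.2 ∈ (1 - z.1) • F) {N : ℕ} (hN : Module.finrank ℝ W = N + 1)
    (hB : ∀ A B : Set (ℝ × W), Convex ℝ A → IsCompact A → A.Nonempty →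
      Convex ℝ B → IsCompact B → B.Nonempty →
      polarSum (volume.prod ν) N K A B * polarSum (volume.prod ν) N K K K ≤
        polarSum (volume.prod ν) N K A K * polarSum (volume.prod ν) N K B K)

include hK cK iK hneg hF iF hC hN hB

theorem mul_measureReal_le_slope {A : Set W} (hA : Convex ℝ A) (cA : IsCompact A)
    (hAF : ν.real A = ν.real F) (cF : IsCompact F) {D : ℝ}
    (hD : Tendsto (fun ε : ℝ => ((volume.prod ν).real
      (K + ε • (({0} : Set ℝ) ×ˢ A)) - (volume.prod ν).real K) / ε) (𝓝[>] 0) (𝓝 D)) :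
    ((Module.finrank ℝ W + 1) * (volume.prod ν).real K) ≤ D := by
  have nK : K.Nonempty := iK.mono interior_subset
  have nF : F.Nonempty := iF.mono interior_subset
  have hFc : Convex ℝ F := by
    intro x hx y hy a b ha hb hab
    rw [hF] at *
    simpa using hK hx hy ha hb hab
  have a0 : 0 < ν.real F := measureReal_pos_of_interior ν cF iF
  have nA : A.Nonempty := by
    rw [nonempty_iff_ne_empty]
    rintro rfl
    simp [← hAF] at a0
  have hp := measureReal_pyramid ν cF
  have iP : (interior (pyramid F)).Nonempty := by
    by_contra hi
    rw [not_nonempty_iff_eq_empty] at hi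
    have h0 := (convex_pyramid hFc).addHaar_frontier (volume.prod ν)
    rw [(isCompact_pyramid cF).isClosed.frontier_eq, hi, sdiff_empty] at h0
    rw [measureReal_def, h0] at hp
    have : 0 < ν.real F / (Module.finrank ℝ W + 1) := by positivity
    simp [← hp] at this
  have hAc : Convex ℝ (({0} : Set ℝ) ×ˢ A) := (convex_singleton 0).prod hA
  have cAc : IsCompact (({0} : Set ℝ) ×ˢ A) := isCompact_singleton.prod cA
  have nAc : (({0} : Set ℝ) ×ˢ A).Nonempty := (singleton_nonempty 0).prod nA
  obtain ⟨D', hD'⟩ := exists_tendsto_measureReal_slope (volume.prod ν) (convex_pyramid hFc)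
    (isCompact_pyramid cF) iP hAc cAc nAc
  have key := slope_mul_le (volume.prod ν) (N := N) (by rw [finrank_real_prod, hN]) hK nK
    (fun k ε hk => measureReal_convexHull_insert_apex_add hK hneg hF hC nK ν cK cA hk)
    cAc hAc nAc (by rw [measureReal_def, Measure.prod_prod]; simp)
    (iP.mono interior_subset)
    (fun B hBc cB nB => hB _ B (convex_convexHull ℝ _)
      (cK.convexHull_insert_of_convex hK nK _) (insert_nonempty _ _).convexHull hBc cB nB) hD hD'
  have hle : ν.real F ≤ D' := by
    have h := tendsto_one_add_mul_pow_slope (Module.finrank ℝ W + 1) 1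
      (ν.real F / (Module.finrank ℝ W + 1)) 0
    have hpow : Tendsto (fun ε : ℝ => ε ^ Module.finrank ℝ W *
        (ν.real F / (Module.finrank ℝ W + 1))) (𝓝[>] 0) (𝓝 0) := by
      refine Tendsto.mono_left ?_ nhdsWithin_le_nhds
      have : Continuous fun ε : ℝ => ε ^ Module.finrank ℝ W *
        (ν.real F / (Module.finrank ℝ W + 1)) := by fun_prop
      simpa [hN] using this.tendsto 0
    have h' := h.sub hpow
    have e : 1 * (((Module.finrank ℝ W + 1 : ℕ) : ℝ) * (ν.real F / (Module.finrank ℝ W + 1)) - 0)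
        - 0 = ν.real F := by
      push_cast; field_simp; ring
    rw [e] at h'
    refine le_of_tendsto_of_tendsto h' hD' ?_
    filter_upwards [self_mem_nhdsWithin] with ε hε
    have hε : 0 < ε := hε
    have := le_measureReal_coneSlab ν cF nF cA hAF hε
    have e1 := smul_pyramid_add (F := F) (A := A) zero_le_one ε
    rw [one_smul] at e1
    rw [e1, hp, le_div_iff₀ hε, sub_mul, div_mul_cancel₀ _ hε.ne']
    refine le_trans (le_of_eq ?_) (sub_le_sub_right this _)
    simp only [pow_succ]
    ring
  rw [hp] at key
  have : ν.real F * (volume.prod ν).real K ≤ D * (ν.real F / (Module.finrank ℝ W + 1)) :=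
    le_trans (by gcongr) key
  rw [mul_div_assoc', le_div_iff₀ (by positivity)] at this
  refine le_of_mul_le_mul_left ?_ a0
  linarith

theorem measureReal_slice_le (cF : IsCompact F) {T : ℝ} (hT : 0 < T) {q : W} (hq : (-T, q) ∈ K)
    {t : ℝ} (ht : 0 < t) (htT : t ≤ T) :
    ν.real (Prod.mk (-t) ⁻¹' K) ≤ ν.real F * (1 - t * ν.real F /
      ((Module.finrank ℝ W + 1) * (volume.prod ν).real K)) ^ Module.finrank ℝ W := by
  have V0 : 0 < (volume.prod ν).real K := measureReal_pos_of_interior _ cK iK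
  have a0 : 0 < ν.real F := measureReal_pos_of_interior ν cF iF
  set H := Prod.mk (-t) ⁻¹' K with hH
  set V := (volume.prod ν).real K with hV
  set m := Module.finrank ℝ W with hm
  set a := ν.real F with ha
  have hm0 : m ≠ 0 := by omega
  have cH : IsCompact H := by
    have : H = Prod.snd '' (K ∩ {z | z.1 = -t}) := by
      ext y
      constructor
      · exact fun h => ⟨(-t, y), ⟨h, rfl⟩, rfl⟩
      · rintro ⟨⟨u, y⟩, ⟨h, h'⟩, rfl⟩
        obtain rfl : u = -t := h'
        exact h
    rw [this]
    exact (cK.inter_right (isClosed_eq continuous_fst continuous_const)).image continuous_snd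
  have hHc : Convex ℝ H := by
    intro x hx y hy α β hα hβ hab
    have := hK hx hy hα hβ hab
    rw [hH, mem_preimage]
    convert this using 1
    ext
    · simp; linear_combination t * hab
    · simp
  have hnonneg : 0 ≤ 1 - t * a / ((m + 1) * V) := by
    have h := le_measureReal_of_apex ν hK cK (fun y => (hF y).1) hT hq
    rw [div_le_iff₀ (by positivity)] at h
    have : t * a ≤ a * T := by rw [mul_comm]; gcongr
    rw [sub_nonneg, div_le_one (by positivity)]
    linarith
  rcases measureReal_nonneg.eq_or_lt (a := (0 : ℝ)) (b := ν.real H) with h0 | h0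
  · rw [← h0]
    exact mul_nonneg a0.le (pow_nonneg hnonneg _)
  set c := (a / ν.real H) ^ ((m : ℝ)⁻¹) with hc
  have c0 : 0 < c := Real.rpow_pos_of_pos (by positivity) _
  have hcm : c ^ m * ν.real H = a := by
    rw [hc, Real.rpow_inv_natCast_pow (by positivity) hm0]
    field_simp
  have hcH : ν.real (c • H) = a := by rw [measureReal_smul ν c0.le, hcm]
  have nH : (c • H).Nonempty := by
    rw [nonempty_iff_ne_empty]
    intro h
    rw [h] at hcH
    simp at hcH
    linarith
  obtain ⟨D, hD⟩ := exists_tendsto_measureReal_slope (volume.prod ν) hK cK iK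
    ((convex_singleton (0 : ℝ)).prod (hHc.smul c)) (isCompact_singleton.prod (cH.smul c))
    ((singleton_nonempty 0).prod nH)
  have h1 := mul_measureReal_le_slope ν hK cK iK hneg hF iF hC hN hB (hHc.smul c) (cH.smul c)
    hcH cF hD
  have h2 := slope_le_of_slice ν hK cK (fun y => (hF y).1) hT hq hneg ht htT c0.le hD
  have h3 : 1 ≤ c * (1 - t * a / ((m + 1) * V)) := by
    have h4 := h1.trans h2
    have e : c * ((m + 1) * V - t * a) = c * (1 - t * a / ((m + 1) * V)) * ((m + 1) * V) := by
      field_simp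
    rw [e] at h4
    exact le_of_mul_le_mul_right (by linarith) (by positivity : 0 < (m + 1) * V)
  have h5 := one_le_pow₀ h3 (n := m)
  rw [mul_pow] at h5
  calc ν.real H ≤ ν.real H * (c ^ m * (1 - t * a / ((m + 1) * V)) ^ m) :=
        le_mul_of_one_le_right h0.le h5
    _ = _ := by rw [← mul_assoc, mul_comm (ν.real H), hcm]

/-- A convex body satisfying the Bezout inequality is a cone over any of its facets. -/
theorem exists_eq_convexHull_insert :
    ∃ q ∈ K, q.1 < 0 ∧ K = convexHull ℝ (insert q (({0} : Set ℝ) ×ˢ F)) := by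
  have nK : K.Nonempty := iK.mono interior_subset
  have V0 : 0 < (volume.prod ν).real K := measureReal_pos_of_interior _ cK iK
  have cF : IsCompact F := by
    have : F = Prod.snd '' (K ∩ {z | z.1 = 0}) := by
      ext y
      rw [hF]
      constructor
      · exact fun h => ⟨(0, y), ⟨h, rfl⟩, rfl⟩
      · rintro ⟨⟨t, y⟩, ⟨h, h'⟩, rfl⟩
        obtain rfl : t = 0 := h'
        exact h
    rw [this]
    exact (cK.inter_right (isClosed_eq continuous_fst continuous_const)).image continuous_snd
  have a0 : 0 < ν.real F := measureReal_pos_of_interior ν cF iF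
  obtain ⟨⟨τ, q⟩, hq, hmin⟩ := cK.exists_isMinOn nK (continuous_fst.continuousOn)
  have hmin : ∀ z ∈ K, τ ≤ z.1 := fun z hz => hmin hz
  have hτ : τ < 0 := by
    refine (hneg _ hq).lt_of_ne fun h => ?_
    obtain rfl : τ = 0 := h
    have : K ⊆ {z | z.1 = 0} := fun z hz => le_antisymm (hneg z hz) (hmin z hz)
    have := measure_mono_null this (prod_measure_height_eq_zero ν 0)
    simp [measureReal_def, this] at V0
  obtain ⟨T, rfl⟩ : ∃ T, τ = -T := ⟨-τ, by ring⟩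
  have hT : 0 < T := by linarith
  set Q := convexHull ℝ (insert (-T, q) (({0} : Set ℝ) ×ˢ F)) with hQ
  have hFc : Convex ℝ F := by
    intro x hx y hy a b ha hb hab
    rw [hF] at *
    simpa using hK hx hy ha hb hab
  have cQ : IsCompact Q :=
    (isCompact_singleton.prod cF).convexHull_insert_of_convex ((convex_singleton 0).prod hFc)
      ((singleton_nonempty 0).prod (iF.mono interior_subset)) _
  have hQK : Q ⊆ K := by
    refine convexHull_min (insert_subset hq ?_) hK
    rintro ⟨u, y⟩ ⟨hu, hy⟩
    obtain rfl : u = 0 := hu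
    exact (hF y).1 hy
  refine ⟨_, hq, hτ, Subset.antisymm ?_ hQK⟩
  refine hK.subset_of_measureReal_le (volume.prod ν) cK iK cQ hQK ?_
  have hVQ : ν.real F * T / (Module.finrank ℝ W + 1) ≤ (volume.prod ν).real Q :=
    le_measureReal_of_apex ν (convex_convexHull ℝ _) cQ
      (fun y hy => subset_convexHull ℝ _ (mem_insert_of_mem _ ⟨rfl, hy⟩)) hT
      (subset_convexHull ℝ _ (mem_insert _ _))
  refine le_trans ?_ hVQ
  set V := (volume.prod ν).real K with hV
  set m := Module.finrank ℝ W with hm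
  set a := ν.real F with ha
  have hup : V ≤ ∫ u in (-T)..0, a * (1 + a / ((m + 1) * V) * u) ^ m := by
    refine measureReal_le_integral_of_slices ν cK (by linarith) (by fun_prop)
      (fun z hz => ⟨hmin z hz, hneg z hz⟩) fun u hu => ?_
    rcases hu.2.eq_or_lt with rfl | hu0
    · have : Prod.mk (0 : ℝ) ⁻¹' K = F := by ext y; exact (hF y).symm
      simp [this, ha]
    · have := measureReal_slice_le ν hK cK iK hneg hF iF hC hN hB cF hT hq (t := -u)
        (by linarith) (by linarith [hu.1])
      rw [neg_neg] at this
      refine this.trans (le_of_eq ?_)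
      simp only [← hm, ← ha, ← hV]
      ring
  rw [intervalIntegral.integral_const_mul, integral_one_add_mul_pow _ _ (by positivity)] at hup
  have e : a * ((1 - (1 - a / ((m + 1) * V) * T) ^ (m + 1)) / (a / ((m + 1) * V) * (m + 1))) =
      V - V * (1 - a / ((m + 1) * V) * T) ^ (m + 1) := by
    field_simp
  rw [e] at hup
  have h1 : (1 - a / ((m + 1) * V) * T) ^ (m + 1) ≤ 0 := by
    by_contra! h
    nlinarith [mul_pos V0 h]
  have h2 : 1 - a / ((m + 1) * V) * T ≤ 0 := by
    by_contra! h
    exact absurd (pow_pos h (m + 1)) (by linarith)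
  rw [le_div_iff₀ (by positivity)]
  have h3 : a / ((m + 1) * V) * T = a * T / ((m + 1) * V) := by ring
  rw [h3, sub_nonpos, one_le_div (by positivity)] at h2
  linarith

end Main

section Facet

variable {E : Type*} [NormedAddCommGroup E] [NormedSpace ℝ E]

/-- Every point of a finite set is missed by some supporting hyperplane through a facet. -/
theorem exists_facet (s : Finset E) (p : E) :
    ∃ (f : E →L[ℝ] ℝ) (h : ℝ), (∀ x ∈ s, f x ≤ h) ∧ f p < h ∧
      ∀ (g : E →L[ℝ] ℝ) (c : ℝ), (∀ x ∈ s, f x = h → g x = c) → g p = c → ∀ x ∈ s, g x = c := by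
  classical
  by_contra! H
  have tilt (f : E →L[ℝ] ℝ) (h : ℝ) (hf : ∀ x ∈ s, f x ≤ h) (hp : f p < h) (g : E →L[ℝ] ℝ) (c : ℝ)
      (hg : ∀ x ∈ s, f x = h → g x = c) (hgp : g p = c) (hx : ∃ x ∈ s, c < g x) :
      ∃ (f' : E →L[ℝ] ℝ) (h' : ℝ), (∀ x ∈ s, f' x ≤ h') ∧ f' p < h' ∧
        (s.filter fun x => f x = h).card < (s.filter fun x => f' x = h').card := by
    obtain ⟨x₀, hx₀, hcx₀⟩ := hx
    obtain ⟨y, hy, hmin⟩ := (s.filter fun x => c < g x).exists_min_image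
      (fun x => (h - f x) / (g x - c)) ⟨x₀, by simp [hx₀, hcx₀]⟩
    rw [Finset.mem_filter] at hy
    have hyc : 0 < g y - c := by linarith [hy.2]
    set l := (h - f y) / (g y - c) with hl
    have l0 : 0 ≤ l := div_nonneg (by linarith [hf y hy.1]) hyc.le
    have hly : l * (g y - c) = h - f y := by rw [hl]; field_simp
    refine ⟨f + l • g, h + l * c, fun x hx => ?_, ?_, Finset.card_lt_card ?_⟩
    · simp only [add_apply, smul_apply, smul_eq_mul]
      rcases le_or_gt (g x) c with hxc | hxc
      · exact add_le_add (hf x hx) (mul_le_mul_of_nonneg_left hxc l0)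
      · have := hmin x (by simp [hx, hxc])
        rw [le_div_iff₀ (by linarith)] at this
        linarith
    · simp only [add_apply, smul_apply, smul_eq_mul, hgp]
      linarith
    · rw [Finset.ssubset_iff_of_subset]
      · refine ⟨y, ?_, ?_⟩
        · simp only [Finset.mem_filter, hy.1, true_and, add_apply, smul_apply, smul_eq_mul]
          linarith
        · simp only [Finset.mem_filter, not_and]
          intro _ h'
          linarith [hg y hy.1 h']
      · intro x hx
        rw [Finset.mem_filter] at hx ⊢
        simp [hx.1, hx.2, hg x hx.1 hx.2]
  have grow (k : ℕ) : ∃ (f : E →L[ℝ] ℝ) (h : ℝ), (∀ x ∈ s, f x ≤ h) ∧ f p < h ∧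
      k ≤ (s.filter fun x => f x = h).card := by
    induction k with
    | zero => exact ⟨0, 1, by simp, by simp, by simp⟩
    | succ k ih =>
      obtain ⟨f, h, hf, hp, hk⟩ := ih
      obtain ⟨g, c, hg, hgp, x, hx, hne⟩ := H f h hf hp
      rcases lt_or_gt_of_ne hne with hlt | hlt
      · obtain ⟨f', h', h1, h2, h3⟩ := tilt f h hf hp (-g) (-c) (fun x hx hxh => by simp [hg x hx hxh])
          (by simp [hgp]) ⟨x, hx, by simpa using hlt⟩
        exact ⟨f', h', h1, h2, by omega⟩
      · obtain ⟨f', h', h1, h2, h3⟩ := tilt f h hf hp g c hg hgp ⟨x, hx, hlt⟩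
        exact ⟨f', h', h1, h2, by omega⟩
  obtain ⟨f, h, -, -, hk⟩ := grow (s.card + 1)
  have := Finset.card_filter_le s fun x => f x = h
  omega

theorem ContinuousLinearMap.eq_zero_of_const_on {K : Set E} (iK : (interior K).Nonempty)
    {g : E →L[ℝ] ℝ} {c : ℝ} (h : ∀ x ∈ K, g x = c) : g = 0 := by
  obtain ⟨x, hx⟩ := iK
  have h1 : (g : E → ℝ) =ᶠ[𝓝 x] fun _ => c := by
    filter_upwards [isOpen_interior.mem_nhds hx] with y hy using h y (interior_subset hy)
  have := h1.fderiv_eq (𝕜 := ℝ)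
  rwa [g.fderiv, fderiv_const_apply] at this

theorem exists_equiv_prod_of_ne_zero [FiniteDimensional ℝ E] {W : Type*} [NormedAddCommGroup W]
    [NormedSpace ℝ W] [FiniteDimensional ℝ W]
    (hE : Module.finrank ℝ E = Module.finrank ℝ W + 1) {f : E →L[ℝ] ℝ} (hf : f ≠ 0) :
    ∃ e : E ≃L[ℝ] ℝ × W, ∀ x, (e x).1 = f x := by
  obtain ⟨v, hv⟩ : ∃ v, f v ≠ 0 := by
    by_contra! h
    exact hf (ContinuousLinearMap.ext h)
  let e₁ := ContinuousLinearEquiv.equivOfRightInverse f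
    (ContinuousLinearMap.toSpanSingleton ℝ ((f v)⁻¹ • v)) (fun t => by simp [hv])
  have hk : Module.finrank ℝ f.ker = Module.finrank ℝ W := by
    have := e₁.toLinearEquiv.finrank_eq
    rw [Module.finrank_prod, Module.finrank_self] at this
    omega
  exact ⟨e₁.trans (ContinuousLinearEquiv.prodCongr (ContinuousLinearEquiv.refl ℝ ℝ)
    (ContinuousLinearEquiv.ofFinrankEq hk)), fun x => rfl⟩

end Facet

section Transport

theorem polarSum_add_singleton {E : Type*} [AddCommGroup E] [Module ℝ E] [MeasurableSpace E]
    [MeasurableAdd E] (μ : Measure E) [μ.IsAddRightInvariant] (N : ℕ) (K A B : Set E)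
    (t a b : E) : polarSum μ N (K + {t}) (A + {a}) (B + {b}) = polarSum μ N K A B := by
  rw [polarSum, polarSum]
  congr 1
  ext k
  rw [smul_add, smul_set_singleton, add_add_add_comm A, singleton_add_singleton,
    add_add_add_comm (A + B), singleton_add_singleton, add_add_add_comm A, singleton_add_singleton,
    add_add_add_comm B, singleton_add_singleton]
  simp only [measureReal_add_singleton]

variable {E E' : Type*} [NormedAddCommGroup E] [NormedSpace ℝ E] [FiniteDimensional ℝ E]
    [MeasurableSpace E] [BorelSpace E] (μ : Measure E) [μ.IsAddHaarMeasure]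
    [NormedAddCommGroup E'] [NormedSpace ℝ E']
    [MeasurableSpace E'] [BorelSpace E'] (μ' : Measure E') [μ'.IsAddHaarMeasure] (e : E ≃L[ℝ] E')

theorem exists_measureReal_image_eq : ∃ c : ℝ, ∀ X : Set E, μ'.real (e '' X) = c * μ.real X := by
  have : FiniteDimensional ℝ E' := e.toLinearEquiv.finiteDimensional
  have h := Measure.isAddLeftInvariant_eq_smul (μ'.map e.symm) μ
  refine ⟨((Measure.map e.symm μ').addHaarScalarFactor μ : ℝ), fun X => ?_⟩
  have h' : Measure.map e.symm μ' X = μ' (e '' X) := by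
    rw [ContinuousLinearEquiv.image_eq_preimage_symm]
    exact e.symm.toHomeomorph.measurableEmbedding.map_apply μ' X
  have h'' := congrArg (fun m => m X) h
  simp only [Measure.smul_apply, ENNReal.smul_def, smul_eq_mul] at h''
  rw [measureReal_def, ← h', h'', ENNReal.toReal_mul, measureReal_def, coe_toReal]

omit [FiniteDimensional ℝ E] [BorelSpace E] [μ.IsAddHaarMeasure] [BorelSpace E']
    [μ'.IsAddHaarMeasure] in
theorem polarSum_image {c : ℝ} (hc : ∀ X : Set E, μ'.real (e '' X) = c * μ.real X) (N : ℕ)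
    (K A B : Set E) :
    polarSum μ' N (e '' K) (e '' A) (e '' B) = polarSum μ N K A B * c := by
  rw [polarSum, polarSum, ← altSum_mul_const]
  congr 1
  ext k
  rw [← image_smul_set, ← image_add, ← image_add, ← image_add, ← image_add, hc, hc, hc, hc]
  ring

end Transport

section Coordinates

theorem Convex.exists_const_on_of_not_interior_nonempty {W : Type*} [NormedAddCommGroup W]
    [NormedSpace ℝ W] [FiniteDimensional ℝ W] [Nontrivial W] {F : Set W} (hF : Convex ℝ F)
    (h : ¬ (interior F).Nonempty) : ∃ g : W →L[ℝ] ℝ, g ≠ 0 ∧ ∃ c, ∀ y ∈ F, g y = c := by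
  rw [hF.interior_nonempty_iff_affineSpan_eq_top] at h
  rcases F.eq_empty_or_nonempty with rfl | ⟨y₁, hy₁⟩
  · obtain ⟨v, hv⟩ := exists_ne (0 : W)
    obtain ⟨g, hg⟩ := SeparatingDual.exists_ne_zero (R := ℝ) hv
    exact ⟨g, fun h => hg (by simp [h]), 0, by simp⟩
  · have hd : (affineSpan ℝ F).direction < ⊤ := by
      rw [lt_top_iff_ne_top]
      exact fun hd => h ((AffineSubspace.direction_eq_top_iff_of_nonempty
        ⟨y₁, subset_affineSpan ℝ F hy₁⟩).1 hd)
    obtain ⟨g, hg, hle⟩ := Submodule.exists_le_ker_of_lt_top _ hd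
    refine ⟨LinearMap.toContinuousLinearMap g, fun h => hg ?_, g y₁, fun y hy => ?_⟩
    · ext x
      exact congrArg (fun f : W →L[ℝ] ℝ => f x) h
    · have := hle (AffineSubspace.vsub_mem_direction (subset_affineSpan ℝ F hy)
        (subset_affineSpan ℝ F hy₁))
      rw [LinearMap.mem_ker, vsub_eq_sub, map_sub, sub_eq_zero] at this
      exact this

theorem exists_coordinates_interior_facet_nonempty {E W : Type*} [NormedAddCommGroup E]
    [NormedSpace ℝ E] [FiniteDimensional ℝ E] [NormedAddCommGroup W] [NormedSpace ℝ W]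
    [FiniteDimensional ℝ W] [Nontrivial W] (hE : Module.finrank ℝ E = Module.finrank ℝ W + 1)
    {s : Finset E} (iK : (interior (convexHull ℝ (s : Set E))).Nonempty) (p : E) :
    ∃ (e : E ≃L[ℝ] ℝ × W) (h : ℝ), (∀ x ∈ s, (e x).1 ≤ h) ∧ (e p).1 < h ∧
      (interior {y : W | (h, y) ∈ e '' convexHull ℝ (s : Set E)}).Nonempty := by
  obtain ⟨f, h, hf, hfp, hface⟩ := exists_facet s p
  have hface' (g : E →L[ℝ] ℝ) (c : ℝ) (h1 : ∀ x ∈ s, f x = h → g x = c) (h2 : g p = c) :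
      g = 0 := by
    refine ContinuousLinearMap.eq_zero_of_const_on iK (c := c) fun x hx => ?_
    exact convexHull_min (hface g c h1 h2) (convex_hyperplane g.toLinearMap.isLinear c) hx
  have : Nontrivial E := Module.nontrivial_of_finrank_pos (R := ℝ) (by omega)
  have f0 : f ≠ 0 := by
    rintro rfl
    obtain ⟨v, hv⟩ := exists_ne (0 : E)
    obtain ⟨g, hg⟩ := SeparatingDual.exists_ne_zero (R := ℝ) hv
    refine hg ?_
    rw [hface' g (g p) (fun x _ hx => absurd hx hfp.ne) rfl]
    simp
  obtain ⟨e, he⟩ := exists_equiv_prod_of_ne_zero (W := W) hE f0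
  refine ⟨e, h, fun x hx => (he x).trans_le (hf x hx), (he p).trans_lt hfp, ?_⟩
  by_contra hi
  have cF : Convex ℝ {y : W | (h, y) ∈ e '' convexHull ℝ (s : Set E)} := by
    have := (convex_convexHull ℝ (s : Set E)).linear_image e.toLinearMap
    intro y hy z hz a b ha hb hab
    have := this hy hz ha hb hab
    rwa [Prod.smul_mk, Prod.smul_mk, Prod.mk_add_mk, ← add_smul, hab, one_smul] at this
  obtain ⟨g, hg, c, hc⟩ := cF.exists_const_on_of_not_interior_nonempty hi
  have hd : f p - h ≠ 0 := (sub_neg.2 hfp).ne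
  set α := (c - g (e p).2) / (f p - h) with hα
  have hα' : α * (f p - h) = c - g (e p).2 := div_mul_cancel₀ _ hd
  have key := hface' (g.comp ((ContinuousLinearMap.snd ℝ ℝ W).comp (e : E →L[ℝ] ℝ × W)) + α • f)
    (c + α * h) (fun x hx hxh => ?_) ?_
  · refine hg (ContinuousLinearMap.ext fun y => ?_)
    have := congrArg (fun k : E →L[ℝ] ℝ => k (e.symm (0, y))) key
    simpa [← he] using this
  · have := hc (e x).2 ⟨x, subset_convexHull ℝ _ hx, by ext <;> simp [he, hxh]⟩
    simp [this, hxh]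
  · simp only [add_apply, ContinuousLinearMap.comp_apply, ContinuousLinearMap.coe_snd',
      ContinuousLinearEquiv.coe_coe, smul_apply, smul_eq_mul]
    linarith

end Coordinates

section Bezout

variable {E E' : Type*} [NormedAddCommGroup E] [NormedSpace ℝ E] [FiniteDimensional ℝ E]
    [MeasurableSpace E] [BorelSpace E] (μ : Measure E) [μ.IsAddHaarMeasure]
    [NormedAddCommGroup E'] [NormedSpace ℝ E']
    [MeasurableSpace E'] [BorelSpace E'] (μ' : Measure E') [μ'.IsAddHaarMeasure]

theorem polarSum_mul_le_image (e : E ≃L[ℝ] E') (t : E') (N : ℕ) {K : Set E}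
    (hB : ∀ A B : Set E, Convex ℝ A → IsCompact A → A.Nonempty →
      Convex ℝ B → IsCompact B → B.Nonempty →
      polarSum μ N K A B * polarSum μ N K K K ≤ polarSum μ N K A K * polarSum μ N K B K)
    (A B : Set E') (hA : Convex ℝ A) (cA : IsCompact A) (nA : A.Nonempty)
    (hB' : Convex ℝ B) (cB : IsCompact B) (nB : B.Nonempty) :
    polarSum μ' N (e '' K + {t}) A B *
      polarSum μ' N (e '' K + {t}) (e '' K + {t}) (e '' K + {t}) ≤
    polarSum μ' N (e '' K + {t}) A (e '' K + {t}) *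
      polarSum μ' N (e '' K + {t}) B (e '' K + {t}) := by
  obtain ⟨c, hc⟩ := exists_measureReal_image_eq μ μ' e
  have hz (X : Set E') : e '' (e.symm '' X) + {0} = X := by
    rw [image_image]
    simp
  have h := hB (e.symm '' A) (e.symm '' B) (hA.linear_image e.symm.toLinearMap)
    (cA.image e.symm.continuous) (nA.image _) (hB'.linear_image e.symm.toLinearMap)
    (cB.image e.symm.continuous) (nB.image _)
  rw [← hz A, ← hz B]
  simp only [polarSum_add_singleton, polarSum_image μ μ' e hc]
  nlinarith [mul_le_mul_of_nonneg_left h (mul_self_nonneg c)]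

end Bezout

section Apex

theorem exists_eq_convexHull_insert_face {E : Type*} [NormedAddCommGroup E] [NormedSpace ℝ E]
    [FiniteDimensional ℝ E] [MeasurableSpace E] [BorelSpace E] (μ : Measure E)
    [μ.IsAddHaarMeasure] {N : ℕ} (hN : Module.finrank ℝ E = N + 2) {s : Finset E} {K : Set E}
    (hs : K = convexHull ℝ (s : Set E)) (iK : (interior K).Nonempty)
    (hB : ∀ A B : Set E, Convex ℝ A → IsCompact A → A.Nonempty →
      Convex ℝ B → IsCompact B → B.Nonempty →
      polarSum μ N K A B * polarSum μ N K K K ≤ polarSum μ N K A K * polarSum μ N K B K)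
    (p : E) :
    ∃ (f : E →L[ℝ] ℝ) (h : ℝ) (q : E), (∀ x ∈ s, f x ≤ h) ∧ f p < h ∧
      K = convexHull ℝ (insert q (K ∩ {x | f x = h})) := by
  have hW : Module.finrank ℝ (EuclideanSpace ℝ (Fin (N + 1))) = N + 1 := finrank_euclideanSpace_fin
  obtain ⟨e, h, hle, hlt, y₀, hy₀⟩ := exists_coordinates_interior_facet_nonempty
    (W := EuclideanSpace ℝ (Fin (N + 1))) (by omega) (hs ▸ iK) p
  rw [← hs] at hy₀
  obtain ⟨r, r0, hr⟩ := Metric.isOpen_iff.1 isOpen_interior y₀ hy₀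
  obtain ⟨l, l0, hl⟩ : ∃ l : ℝ, 0 < l ∧ ∀ x ∈ s, (e x).1 < h →
      ‖(e x).2 - y₀‖ < r * (l * (h - (e x).1)) := by
    have : ∀ᶠ l : ℝ in atTop, ∀ x ∈ s, (e x).1 < h →
        ‖(e x).2 - y₀‖ < r * (l * (h - (e x).1)) := by
      rw [Filter.eventually_all_finset]
      intro x _
      by_cases hx : (e x).1 < h
      · have ht : Tendsto (fun l : ℝ => r * (l * (h - (e x).1))) atTop atTop :=
          (tendsto_id.atTop_mul_const (sub_pos.2 hx)).const_mul_atTop r0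
        filter_upwards [ht.eventually_gt_atTop ‖(e x).2 - y₀‖] with l hl _ using hl
      · exact Eventually.of_forall fun _ h => absurd h hx
    obtain ⟨l, h1, h2⟩ := ((eventually_gt_atTop 0).and this).exists
    exact ⟨l, h1, h2⟩
  let e' : E ≃L[ℝ] ℝ × EuclideanSpace ℝ (Fin (N + 1)) :=
    e.trans ((ContinuousLinearEquiv.smulLeft (Units.mk0 l l0.ne')).prodCongr
      (ContinuousLinearEquiv.refl ℝ _))
  let t : ℝ × EuclideanSpace ℝ (Fin (N + 1)) := (-(l * h), -y₀)
  let φ : E →ᵃ[ℝ] ℝ × EuclideanSpace ℝ (Fin (N + 1)) :=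
    e'.toLinearMap.toAffineMap + AffineMap.const ℝ E t
  have hφ (x : E) : φ x = (l * ((e x).1 - h), (e x).2 - y₀) := by
    change (l * (e x).1 + -(l * h), (e x).2 + -y₀) = _
    ext <;> simp <;> ring
  have φi : Function.Injective φ := fun x y hxy => e'.injective (add_right_cancel hxy)
  have hK' : e' '' K + {t} = φ '' K := by
    rw [add_singleton, image_image]
    rfl
  have Kc : Convex ℝ K := hs ▸ convex_convexHull ℝ _
  have cK : IsCompact K := hs ▸ s.finite_toSet.isCompact_convexHull (𝕜 := ℝ)
  have φc : Continuous φ := AffineMap.continuous_of_finiteDimensional φ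
  have iK' : (interior (φ '' K)).Nonempty := by
    have : φ '' interior K = interior (φ '' K) :=
      (e'.toHomeomorph.trans (Homeomorph.addRight t)).image_interior K
    exact this ▸ iK.image φ
  have hleK : ∀ x ∈ K, (e x).1 ≤ h := by
    intro x hx
    rw [hs] at hx
    exact convexHull_min (t := {x | (e x).1 ≤ h}) hle
      (convex_halfSpace_le ((LinearMap.fst ℝ ℝ _).comp e.toLinearMap).isLinear h) hx
  set F : Set (EuclideanSpace ℝ (Fin (N + 1))) := {y | ((0 : ℝ), y) ∈ φ '' K} with hF
  have ballF : Metric.ball 0 r ⊆ F := by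
    intro y hy
    have : y + y₀ ∈ Metric.ball y₀ r := by simpa using hy
    obtain ⟨x, hx, hxe⟩ := interior_subset (hr this)
    exact ⟨x, hx, by rw [hφ, hxe]; simp⟩
  have Fc : Convex ℝ F := by
    intro y hy z hz a b ha hb hab
    have := Kc.affine_image φ hy hz ha hb hab
    rwa [Prod.smul_mk, Prod.smul_mk, Prod.mk_add_mk, smul_zero, smul_zero, add_zero] at this
  have hC : ∀ z ∈ φ '' K, z.2 ∈ (1 - z.1) • F := by
    have cC : Convex ℝ {z : ℝ × EuclideanSpace ℝ (Fin (N + 1)) | z.1 ≤ 1 ∧ z.2 ∈ (1 - z.1) • F} := by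
      rintro z ⟨hz1, hz⟩ w ⟨hw1, hw⟩ a b ha hb hab
      refine ⟨by simp only [Prod.fst_add, Prod.smul_fst, smul_eq_mul]; nlinarith, ?_⟩
      have h1 : 1 - (a • z + b • w).1 = a * (1 - z.1) + b * (1 - w.1) := by
        simp only [Prod.fst_add, Prod.smul_fst, smul_eq_mul]
        linear_combination -hab
      rw [h1, Fc.add_smul (mul_nonneg ha (by linarith)) (mul_nonneg hb (by linarith)), mul_smul,
        mul_smul]
      exact add_mem_add (smul_mem_smul_set hz) (smul_mem_smul_set hw)
    rintro _ ⟨x, hx, rfl⟩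
    rw [hs] at hx
    refine (convexHull_min ?_ (cC.affine_preimage φ) hx).2
    intro x hx
    have hxl := hle x hx
    simp only [mem_preimage, mem_ofPred_eq]
    rcases hxl.eq_or_lt with hxe | hxl'
    · have h0 : (φ x).1 = 0 := by rw [hφ, hxe]; simp
      refine ⟨by rw [h0]; norm_num, ?_⟩
      rw [h0, sub_zero, one_smul]
      refine ⟨x, hs ▸ subset_convexHull ℝ _ hx, ?_⟩
      rw [← h0]
    · have hpos : 0 < 1 - (φ x).1 := by
        rw [hφ]
        nlinarith
      refine ⟨by linarith, ?_⟩
      rw [mem_smul_set_iff_inv_smul_mem₀ hpos.ne']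
      refine ballF ?_
      rw [mem_ball_zero_iff, norm_smul, norm_inv, Real.norm_of_nonneg hpos.le,
        inv_mul_lt_iff₀ hpos]
      have := hl x hx hxl'
      rw [hφ]
      simp only
      nlinarith
  obtain ⟨_, ⟨q, hq, rfl⟩, -, hKq⟩ := exists_eq_convexHull_insert
    (volume : Measure (EuclideanSpace ℝ (Fin (N + 1)))) (K := φ '' K) (F := F)
    (Kc.affine_image φ) (cK.image φc) iK'
    (by
      rintro _ ⟨x, hx, rfl⟩
      rw [hφ]
      have := hleK x hx
      simp only
      nlinarith)
    (fun y => Iff.rfl)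
    ⟨0, interior_mono ballF (by rw [Metric.isOpen_ball.interior_eq]; exact Metric.mem_ball_self r0)⟩
    hC hW
    (fun A B h1 h2 h3 h4 h5 h6 => by
      rw [← hK']
      exact polarSum_mul_le_image μ _ e' t N hB A B h1 h2 h3 h4 h5 h6)
  refine ⟨(ContinuousLinearMap.fst ℝ ℝ (EuclideanSpace ℝ (Fin (N + 1)))).comp
    (e : E →L[ℝ] ℝ × EuclideanSpace ℝ (Fin (N + 1))), h, q, hle, hlt, ?_⟩
  refine φi.image_injective ?_
  rw [AffineMap.image_convexHull, image_insert_eq]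
  convert hKq using 3
  ext ⟨a, y⟩
  simp only [mem_prod, mem_singleton_iff, hF, mem_ofPred_eq]
  constructor
  · rintro ⟨x, ⟨hx, hxh⟩, hxa⟩
    have hxh' : (e x).1 = h := hxh
    have h0 : a = 0 := by
      rw [hφ, hxh'] at hxa
      simpa using (congrArg Prod.fst hxa).symm
    exact ⟨h0, x, hx, by rw [hxa, h0]⟩
  · rintro ⟨rfl, x, hx, hxe⟩
    refine ⟨x, ⟨hx, ?_⟩, hxe⟩
    rw [hφ] at hxe
    have : l * ((e x).1 - h) = 0 := congrArg Prod.fst hxe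
    have := (mul_eq_zero.1 this).resolve_left l0.ne'
    change (e x).1 = h
    linarith

end Apex

section Simplex

theorem exists_affineIndependent_of_face {E : Type*} [NormedAddCommGroup E] [NormedSpace ℝ E]
    [FiniteDimensional ℝ E] {s : Finset E} {K : Set E} (hs : K = convexHull ℝ (s : Set E))
    (iK : (interior K).Nonempty)
    (hface : ∀ p : E, ∃ (f : E →L[ℝ] ℝ) (h : ℝ) (q : E), (∀ x ∈ s, f x ≤ h) ∧ f p < h ∧
      K = convexHull ℝ (insert q (K ∩ {x | f x = h}))) :
    ∃ p : Fin (Module.finrank ℝ E + 1) → E,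
      AffineIndependent ℝ p ∧ K = convexHull ℝ (Set.range p) := by
  set V := K.extremePoints ℝ with hV
  have hVs : V ⊆ s := by
    rw [hV, hs]
    exact extremePoints_convexHull_subset
  have fV : V.Finite := s.finite_toSet.subset hVs
  have hKV : K = convexHull ℝ V := by
    have cK : IsCompact K := hs ▸ s.finite_toSet.isCompact_convexHull (𝕜 := ℝ)
    have := closure_convexHull_extremePoints cK (hs ▸ convex_convexHull ℝ _)
    rw [← this, (fV.isClosed_convexHull (𝕜 := ℝ)).closure_eq]
  have hsep (p : E) (hp : p ∈ V) : ∃ (f : E →L[ℝ] ℝ) (h : ℝ), f p ≠ h ∧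
      ∀ x ∈ V, x ≠ p → f x = h := by
    obtain ⟨f, h, q, hf, hfp, hKq⟩ := hface p
    have hq (x : E) (hx : x ∈ V) (hxh : f x ≠ h) : x = q := by
      rw [hV, hKq] at hx
      exact (extremePoints_convexHull_subset hx).resolve_right fun h => hxh h.2
    refine ⟨f, h, hfp.ne, fun x hx hxp => ?_⟩
    by_contra hxh
    exact hxp ((hq x hx hxh).trans (hq p hp hfp.ne).symm)
  have : Fintype V := fV.fintype
  have hind : AffineIndependent ℝ ((↑) : V → E) := by
    rw [affineIndependent_iff]
    intro u w hw hwx p hp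
    obtain ⟨f, h, hfp, hfx⟩ := hsep p p.2
    have h1 : ∑ x ∈ u, w x * (f x - h) = 0 := by
      have := congrArg f hwx
      simp only [map_sum, map_smul, smul_eq_mul, map_zero] at this
      simp only [mul_sub, Finset.sum_sub_distrib, this, ← Finset.sum_mul, hw, zero_mul, sub_zero]
    rw [Finset.sum_eq_single_of_mem p hp] at h1
    · exact (mul_eq_zero.1 h1).resolve_right (sub_ne_zero.2 hfp)
    · intro x _ hxp
      rw [hfx x x.2 (fun h => hxp (Subtype.ext h)), sub_self, mul_zero]
  have hspan : affineSpan ℝ (Set.range ((↑) : V → E)) = ⊤ := by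
    rw [Subtype.range_coe, ← interior_convexHull_nonempty_iff_affineSpan_eq_top, ← hKV]
    exact iK
  have hcard := hind.affineSpan_eq_top_iff_card_eq_finrank_add_one.1 hspan
  let σ := (Fintype.equivFinOfCardEq hcard).symm
  refine ⟨(↑) ∘ σ, hind.comp_embedding σ.toEmbedding, ?_⟩
  rw [σ.surjective.range_comp, Subtype.range_coe]
  exact hKV

end Simplex

theorem mixedVol_one (X : Fin 1 → Set (EuclideanSpace ℝ (Fin 1))) :
    mixedVol 1 X = volume.real (X 0) := by
  have : (Finset.univ : Finset (Finset (Fin 1))) = {∅, {0}} := by decide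
  rw [mixedVol, this, Finset.sum_pair (by decide)]
  simp [measureReal_def, ← singleton_zero]

theorem polarSum_mul_le {N : ℕ} {K : Set (EuclideanSpace ℝ (Fin (N + 2)))} (hK : Convex ℝ K)
    (nK : K.Nonempty)
    (hBezout : ∀ L M : Set (EuclideanSpace ℝ (Fin (N + 2))), IsConvexBody L → IsConvexBody M →
      mixedVol (N + 2) (fun j => if (j : ℕ) = 0 then L else if (j : ℕ) = 1 then M else K) *
          mixedVol (N + 2) (fun _ => K) ≤
        mixedVol (N + 2) (fun j => if (j : ℕ) = 0 then L else K) *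
          mixedVol (N + 2) (fun j => if (j : ℕ) = 0 then M else K))
    (A B : Set (EuclideanSpace ℝ (Fin (N + 2)))) (hA : IsConvexBody A) (hB : IsConvexBody B) :
    polarSum volume N K A B * polarSum volume N K K K ≤
      polarSum volume N K A K * polarSum volume N K B K := by
  have h := hBezout A B hA hB
  have h1 (L : Set (EuclideanSpace ℝ (Fin (N + 2)))) :
      ((N + 2).factorial : ℝ) * mixedVol (N + 2) (fun j => if (j : ℕ) = 0 then L else K) =
        polarSum volume N K L K := by
    rw [← factorial_mul_mixedVol N hK nK]
    simp only [ite_self]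
  have h2 : ((N + 2).factorial : ℝ) * mixedVol (N + 2) (fun _ => K) = polarSum volume N K K K := by
    rw [← h1]
    simp only [ite_self]
  rw [← factorial_mul_mixedVol N hK nK, ← h2, ← h1, ← h1]
  have := mul_le_mul_of_nonneg_left h (mul_self_nonneg ((N + 2).factorial : ℝ))
  linarith

end

/-- If an `n`-polytope `K` in `ℝⁿ` satisfies
`V(L,M,K[n-2]) V_n(K) ≤ V(L,K[n-1]) V(M,K[n-1])` for all convex bodies `L, M`,
then `K` is a simplex. -/
theorem simplex_of_bezout_two (n : ℕ)
    (K : Set (EuclideanSpace ℝ (Fin n)))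
    (hKpoly : ∃ s : Finset (EuclideanSpace ℝ (Fin n)), K = convexHull ℝ (s : Set _))
    (hKdim : (interior K).Nonempty)
    (hBezout : ∀ L M : Set (EuclideanSpace ℝ (Fin n)), IsConvexBody L → IsConvexBody M →
      mixedVol n (fun j : Fin n => if (j : ℕ) = 0 then L else if (j : ℕ) = 1 then M else K) *
          mixedVol n (fun _ => K) ≤
        mixedVol n (fun j : Fin n => if (j : ℕ) = 0 then L else K) *
          mixedVol n (fun j : Fin n => if (j : ℕ) = 0 then M else K)) :
    ∃ p : Fin (n + 1) → EuclideanSpace ℝ (Fin n),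
      AffineIndependent ℝ p ∧ K = convexHull ℝ (Set.range p) := by
  obtain ⟨s, hs⟩ := hKpoly
  have hK : Convex ℝ K := hs ▸ convex_convexHull ℝ _
  have cK : IsCompact K := hs ▸ s.finite_toSet.isCompact_convexHull (𝕜 := ℝ)
  have nK : K.Nonempty := hKdim.mono interior_subset
  match n with
  | 0 =>
    have : Subsingleton (Fin (0 + 1)) := inferInstanceAs (Subsingleton (Fin 1))
    refine ⟨fun _ => 0, affineIndependent_of_subsingleton ℝ _, ?_⟩
    rw [Subsingleton.eq_univ_of_nonempty nK, Subsingleton.eq_univ_of_nonempty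
      (convexHull_nonempty_iff.2 (Set.range_nonempty _))]
  | 1 =>
    have h := hBezout K {0} ⟨hK, cK, nK⟩
      ⟨convex_singleton 0, isCompact_singleton, Set.singleton_nonempty 0⟩
    simp only [mixedVol_one, Fin.val_zero, if_true, measureReal_def, measure_singleton,
      ENNReal.toReal_zero, mul_zero] at h
    rw [← measureReal_def] at h
    have := measureReal_pos_of_interior volume cK hKdim
    nlinarith
  | N + 2 =>
    have h := exists_affineIndependent_of_face hs hKdim
      (exists_eq_convexHull_insert_face volume finrank_euclideanSpace_fin hs hKdim
        fun A B h1 h2 h3 h4 h5 h6 =>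
          polarSum_mul_le hK nK hBezout A B ⟨h1, h2, h3⟩ ⟨h4, h5, h6⟩)
    rwa [finrank_euclideanSpace_fin] at h
end

section
/- Let K be an n-polytope in ℝ^n such that for every facet F of K and all sufficiently small t ≠ 0, the polytope K_t obtained from K by translating the supporting hyperplane of F by t in its outer normal direction (keeping all other facet inequalities) is homothetic to K. Then K is a simplex. Equivalently: if for every vertex v of K, K is the convex hull of v and the facet of K not containing v, then K is a simplex. -/
open Pointwise MeasureTheory RealInnerProductSpace

/-- The support function `h_K(u) = sup {⟨x,u⟩ : x ∈ K}`. -/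
noncomputable def suppFn {n : ℕ} (K : Set (EuclideanSpace ℝ (Fin n)))
    (u : EuclideanSpace ℝ (Fin n)) : ℝ :=
  sSup ((fun x => ⟪x, u⟫) '' K)

/-- The polytope obtained from `K` (with facet normals `u j`) by moving the `i`-th facet by `t`,
keeping all other facet inequalities. -/
noncomputable def movedPoly {n N : ℕ} (K : Set (EuclideanSpace ℝ (Fin n)))
    (u : Fin N → EuclideanSpace ℝ (Fin n)) (i : Fin N) (t : ℝ) :
    Set (EuclideanSpace ℝ (Fin n)) :=
  {x | ∀ j : Fin N, ⟪x, u j⟫ ≤ suppFn K (u j) + if j = i then t else 0}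

theorem suppFn_isGreatest {n : ℕ} {K : Set (EuclideanSpace ℝ (Fin n))} (hK : IsConvexBody K)
    (v : EuclideanSpace ℝ (Fin n)) : IsGreatest ((fun x => ⟪x, v⟫) '' K) (suppFn K v) :=
  (hK.2.1.image (by fun_prop)).isGreatest_sSup (hK.2.2.image _)

theorem inner_le_suppFn {n : ℕ} {K : Set (EuclideanSpace ℝ (Fin n))} (hK : IsConvexBody K)
    {x : EuclideanSpace ℝ (Fin n)} (hx : x ∈ K) (v : EuclideanSpace ℝ (Fin n)) :
    ⟪x, v⟫ ≤ suppFn K v :=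
  (suppFn_isGreatest hK v).2 ⟨x, hx, rfl⟩

/-- A set contained in a translate of a subspace of dimension less than `m` has zero
`m`-dimensional Hausdorff measure. -/
theorem hausdorffMeasure_eq_zero_of_sub_mem {E : Type*} [NormedAddCommGroup E] [NormedSpace ℝ E]
    [FiniteDimensional ℝ E] [MeasurableSpace E] [BorelSpace E] {s : Set E} (W : Submodule ℝ E)
    (p : E) (hs : ∀ x ∈ s, x - p ∈ W) {m : ℕ} (hm : Module.finrank ℝ W < m) :
    μH[(m : ℝ)] s = 0 := by
  have hsub : s ⊆ Set.range (fun w : W => p + (w : E)) := fun x hx => ⟨⟨x - p, hs x hx⟩, by simp⟩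
  have hiso : Isometry (fun w : W => p + (w : E)) :=
    (IsometryEquiv.addLeft p).isometry.comp W.subtypeₗᵢ.isometry
  have hd : dimH s < ((m : NNReal) : ENNReal) := by
    refine (dimH_mono hsub).trans_lt ?_
    rw [← Set.image_univ, hiso.dimH_image, Real.dimH_univ_eq_finrank]
    exact_mod_cast hm
  simpa using hausdorffMeasure_of_dimH_lt hd

/-- The intersection of two hyperplanes with distinct, non-opposite unit normals has zero
`(n - 1)`-dimensional Hausdorff measure. -/
theorem hausdorffMeasure_hyperplane_inter_eq_zero {n : ℕ} (hn : 1 ≤ n)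
    {v w : EuclideanSpace ℝ (Fin n)} (hv : ‖v‖ = 1) (hw : ‖w‖ = 1) (hne : w ≠ v) (hneg : w ≠ -v)
    (a b : ℝ) : μH[(n : ℝ) - 1] {x : EuclideanSpace ℝ (Fin n) | ⟪x, v⟫ = a ∧ ⟪x, w⟫ = b} = 0 := by
  rcases Set.eq_empty_or_nonempty {x : EuclideanSpace ℝ (Fin n) | ⟪x, v⟫ = a ∧ ⟪x, w⟫ = b} with
    h | ⟨p, hp⟩
  · rw [h, measure_empty]
  have hcast : (n : ℝ) - 1 = ((n - 1 : ℕ) : ℝ) := by push_cast [hn]; rfl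
  rw [hcast]
  have hv0 : v ≠ 0 := by rintro rfl; simp at hv
  have hvv : ⟪v, v⟫ = 1 := by rw [real_inner_self_eq_norm_sq, hv, one_pow]
  have hww : ⟪w, w⟫ = 1 := by rw [real_inner_self_eq_norm_sq, hw, one_pow]
  have hlt : (ℝ ∙ v)ᗮ ⊓ (ℝ ∙ w)ᗮ < (ℝ ∙ v)ᗮ := by
    refine lt_of_le_of_ne inf_le_left fun heq => ?_
    have hz : w - ⟪v, w⟫ • v ∈ (ℝ ∙ v)ᗮ := by
      rw [Submodule.mem_orthogonal_singleton_iff_inner_right, inner_sub_right, inner_smul_right,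
        hvv]
      ring
    have hzw : w - ⟪v, w⟫ • v ∈ (ℝ ∙ w)ᗮ := (heq.ge hz).2
    rw [Submodule.mem_orthogonal_singleton_iff_inner_right, inner_sub_right, inner_smul_right,
      hww, real_inner_comm v w] at hzw
    have hsq : ⟪v, w⟫ ^ 2 = 1 := by linarith [sq ⟪v, w⟫]
    rcases sq_eq_one_iff.mp hsq with h | h
    · exact hne ((inner_eq_one_iff_of_norm_eq_one hv hw).mp h).symm
    · refine hneg ((inner_eq_one_iff_of_norm_eq_one (𝕜 := ℝ) hw (by rwa [norm_neg])).mp ?_)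
      rw [inner_neg_right, real_inner_comm, h, neg_neg]
  refine hausdorffMeasure_eq_zero_of_sub_mem ((ℝ ∙ v)ᗮ ⊓ (ℝ ∙ w)ᗮ) p (fun x hx => ?_) ?_
  · refine ⟨?_, ?_⟩ <;> refine Submodule.mem_orthogonal_singleton_iff_inner_left.mpr ?_ <;>
      rw [inner_sub_left]
    · rw [hx.1, hp.1, sub_self]
    · rw [hx.2, hp.2, sub_self]
  · have h1 := Submodule.finrank_lt_finrank_of_lt hlt
    have h2 := Submodule.finrank_add_finrank_orthogonal (ℝ ∙ v)
    rw [finrank_span_singleton hv0, finrank_euclideanSpace_fin] at h2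
    omega

/-- A set contained in a hyperplane has empty interior. -/
theorem not_interior_nonempty_of_inner_eq {E : Type*} [NormedAddCommGroup E]
    [InnerProductSpace ℝ E] {K : Set E} {v : E} (hv : v ≠ 0) {a : ℝ}
    (h : ∀ x ∈ K, ⟪x, v⟫ = a) : ¬ (interior K).Nonempty := by
  rintro ⟨z, hz⟩
  have hcont : Filter.Tendsto (fun t : ℝ => z + t • v) (nhds 0) (nhds z) := by
    have : Continuous fun t : ℝ => z + t • v := by fun_prop
    simpa using this.tendsto 0
  have hev := hcont (mem_interior_iff_mem_nhds.mp hz)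
  obtain ⟨ε, hε, hball⟩ := Metric.mem_nhds_iff.mp hev
  have hmem : z + (ε / 2) • v ∈ K := hball (by simp [abs_of_pos hε, hε])
  have h1 := h _ hmem
  rw [inner_add_left, h z (interior_subset hz), inner_smul_left] at h1
  have : ε / 2 * ⟪v, v⟫ = 0 := by simpa using h1
  have := real_inner_self_pos.mpr hv
  rcases mul_eq_zero.mp ‹ε / 2 * ⟪v, v⟫ = 0› with h2 | h2 <;> linarith

/-- A facet of full Hausdorff dimension contains a point lying on no other facet hyperplane. -/
theorem exists_mem_facet_forall_lt {n N : ℕ} (hn : 1 ≤ n)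
    {K : Set (EuclideanSpace ℝ (Fin n))} (hK : IsConvexBody K) (hKdim : (interior K).Nonempty)
    {u : Fin N → EuclideanSpace ℝ (Fin n)} (hu : ∀ j, ‖u j‖ = 1) (huinj : Function.Injective u)
    (i : Fin N)
    (hfacet : μH[(n : ℝ) - 1] (K ∩ {x | ⟪x, u i⟫ = suppFn K (u i)}) ≠ 0) :
    ∃ x ∈ K, ⟪x, u i⟫ = suppFn K (u i) ∧ ∀ j, j ≠ i → ⟪x, u j⟫ < suppFn K (u j) := by
  by_contra! hcon
  refine hfacet (measure_mono_null (t := ⋃ j : Fin N, {x | j ≠ i ∧ x ∈ K ∧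
    ⟪x, u i⟫ = suppFn K (u i) ∧ ⟪x, u j⟫ = suppFn K (u j)}) ?_ ?_)
  · rintro x ⟨hx, hxi⟩
    obtain ⟨j, hj, hle⟩ := hcon x hx hxi
    exact Set.mem_iUnion.mpr ⟨j, hj, hx, hxi, le_antisymm (inner_le_suppFn hK hx _) hle⟩
  · refine measure_iUnion_null fun j => ?_
    by_cases hneg : u j = -u i
    · convert measure_empty (μ := μH[(n : ℝ) - 1])
      refine Set.eq_empty_of_forall_notMem fun p hp => ?_
      refine not_interior_nonempty_of_inner_eq (v := u i) (a := suppFn K (u i)) ?_ ?_ hKdim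
      · intro h0
        simpa [h0] using hu i
      · intro x hx
        have h1 := inner_le_suppFn hK hx (u i)
        have h2 := inner_le_suppFn hK hx (u j)
        obtain ⟨-, -, hp1, hp2⟩ := hp
        rw [← hp2, hneg, inner_neg_right, inner_neg_right, hp1] at h2
        linarith
    · by_cases hj : j = i
      · simp [hj]
      · exact measure_mono_null (fun x hx => hx.2.2)
          (hausdorffMeasure_hyperplane_inter_eq_zero hn (hu i) (hu j) (huinj.ne hj) hneg _ _)

/-- Only the zero direction is a recession direction of a nonempty bounded polyhedron. -/
theorem eq_zero_of_inner_nonpos {ι E : Type*} [NormedAddCommGroup E] [InnerProductSpace ℝ E]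
    {K : Set E} (hbdd : Bornology.IsBounded K) (hne : K.Nonempty) {u : ι → E} {h : ι → ℝ}
    (hrep : ∀ x, x ∈ K ↔ ∀ j, ⟪x, u j⟫ ≤ h j) {d : E} (hd : ∀ j, ⟪d, u j⟫ ≤ 0) : d = 0 := by
  obtain ⟨x, hx⟩ := hne
  obtain ⟨R, hR⟩ := hbdd.exists_norm_le
  by_contra h0
  have hpos : 0 < ‖d‖ := norm_pos_iff.mpr h0
  have hR0 : 0 ≤ R := (norm_nonneg x).trans (hR x hx)
  set l : ℝ := (R + R + 1) / ‖d‖ with hl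
  have hl0 : 0 ≤ l := by positivity
  have hmem : x + l • d ∈ K := by
    rw [hrep]
    intro j
    rw [inner_add_left, real_inner_smul_left]
    have := (hrep x).mp hx j
    have := mul_nonpos_of_nonneg_of_nonpos hl0 (hd j)
    linarith
  have h1 : ‖l • d‖ ≤ R + R := by
    calc ‖l • d‖ = ‖(x + l • d) - x‖ := by rw [add_sub_cancel_left]
      _ ≤ ‖x + l • d‖ + ‖x‖ := norm_sub_le _ _
      _ ≤ R + R := add_le_add (hR _ hmem) (hR _ hx)
  rw [norm_smul, Real.norm_of_nonneg hl0, hl, div_mul_cancel₀ _ hpos.ne'] at h1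
  linarith

/-- The homogenization of a bounded polyhedron with at least two points meets the half-space of
nonpositive heights only at the origin. -/
theorem eq_zero_of_homogenization {ι E : Type*} [NormedAddCommGroup E] [InnerProductSpace ℝ E]
    {K : Set E} (hbdd : Bornology.IsBounded K) (hnt : K.Nontrivial) {u : ι → E} {h : ι → ℝ}
    (hrep : ∀ x, x ∈ K ↔ ∀ j, ⟪x, u j⟫ ≤ h j) {y : E} {s : ℝ} (hs : s ≤ 0)
    (hy : ∀ j, ⟪y, u j⟫ ≤ s * h j) : y = 0 ∧ s = 0 := by
  have key : ∀ x ∈ K, y = s • x := by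
    intro x hx
    refine sub_eq_zero.mp (eq_zero_of_inner_nonpos hbdd hnt.nonempty hrep fun j => ?_)
    rw [inner_sub_left, real_inner_smul_left]
    have := mul_le_mul_of_nonpos_left ((hrep x).mp hx j) hs
    linarith [hy j]
  obtain ⟨a, ha, b, hb, hab⟩ := hnt
  have hs0 : s = 0 := by
    by_contra h0
    exact hab (smul_right_injective E h0 ((key a ha).symm.trans (key b hb)))
  exact ⟨by simpa [hs0] using key a ha, hs0⟩

/-- If the bounded polyhedron `K` has a vertex opposite to each of its facets, then these vertices
are affinely independent and span `K`. -/
theorem affineIndependent_and_eq_convexHull {ι E : Type*} [Fintype ι] [DecidableEq ι]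
    [NormedAddCommGroup E] [InnerProductSpace ℝ E] {K : Set E} (hconv : Convex ℝ K)
    (hbdd : Bornology.IsBounded K) (hnt : K.Nontrivial) {u : ι → E} {h : ι → ℝ}
    (hrep : ∀ x, x ∈ K ↔ ∀ j, ⟪x, u j⟫ ≤ h j) {p : ι → E} {r : ι → ℝ} (hr : ∀ i, 0 < r i)
    (hp : ∀ i j, ⟪p i, u j⟫ = h j - if j = i then r i else 0) :
    AffineIndependent ℝ p ∧ K = convexHull ℝ (Set.range p) := by
  have hsum : ∀ (w : ι → ℝ) (j : ι),
      ⟪∑ i, w i • p i, u j⟫ = (∑ i, w i) * h j - w j * r j := by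
    intro w j
    simp [sum_inner, real_inner_smul_left, hp, mul_sub, Finset.sum_mul]
  refine ⟨?_, Set.Subset.antisymm ?_ ?_⟩
  · rw [affineIndependent_iff]
    intro s w hw hwp i hi
    have h1 := hsum (fun i => if i ∈ s then w i else 0) i
    simp only [ite_smul, zero_smul, Finset.sum_ite_mem, Finset.univ_inter, hw, hwp, hi, if_true,
      inner_zero_left, zero_mul, zero_sub] at h1
    have h2 : w i * r i = 0 := by linarith
    exact (mul_eq_zero.mp h2).resolve_right (hr i).ne'
  · intro x hx
    set w : ι → ℝ := fun i => (h i - ⟪x, u i⟫) / r i with hw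
    have hw0 : ∀ i, 0 ≤ w i := fun i => div_nonneg (sub_nonneg.mpr ((hrep x).mp hx i)) (hr i).le
    have hwr : ∀ i, w i * r i = h i - ⟪x, u i⟫ := fun i => div_mul_cancel₀ _ (hr i).ne'
    have hin : ∀ j, ⟪∑ i, w i • p i - x, u j⟫ = (∑ i, w i - 1) * h j := by
      intro j
      rw [inner_sub_left, hsum, hwr]
      ring
    have hz : ∑ i, w i • p i - x = 0 ∧ ∑ i, w i - 1 = 0 := by
      rcases le_total (∑ i, w i - 1) 0 with hle | hle
      · exact eq_zero_of_homogenization hbdd hnt hrep hle fun j => (hin j).le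
      · have := eq_zero_of_homogenization hbdd hnt hrep (y := -(∑ i, w i • p i - x))
          (neg_nonpos.mpr hle) fun j => by rw [inner_neg_left, hin, neg_mul]
        exact ⟨neg_eq_zero.mp this.1, neg_eq_zero.mp this.2⟩
    rw [← sub_eq_zero.mp hz.1]
    exact (convex_convexHull ℝ _).sum_mem (fun i _ => hw0 i) (sub_eq_zero.mp hz.2)
      fun i _ => subset_convexHull ℝ _ ⟨i, rfl⟩
  · refine convexHull_min ?_ hconv
    rintro _ ⟨i, rfl⟩
    rw [hrep]
    intro j
    rw [hp]
    split_ifs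
    · linarith [hr i]
    · linarith

/-- If moving the `i`-th facet outward, by at most the distance from a point of that facet to the
other facet hyperplanes, yields a homothetic copy of `K`, then the support numbers of the copy are
the prescribed ones. -/
theorem inner_add_mul_suppFn_of_movedPoly_eq {n N : ℕ} {K : Set (EuclideanSpace ℝ (Fin n))}
    (hK : IsConvexBody K) {u : Fin N → EuclideanSpace ℝ (Fin n)} (hu : ∀ j, ‖u j‖ = 1)
    {i : Fin N} {x : EuclideanSpace ℝ (Fin n)} (hxi : ⟪x, u i⟫ = suppFn K (u i)) {t : ℝ}
    (ht : 0 < t) (hxt : ∀ j, j ≠ i → ⟪x, u j⟫ + t ≤ suppFn K (u j)) {c : ℝ} (hc : 0 < c)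
    {x₀ : EuclideanSpace ℝ (Fin n)} (heq : movedPoly K u i t = (fun y => x₀ + c • y) '' K)
    (j : Fin N) :
    ⟪x₀, u j⟫ + c * suppFn K (u j) = suppFn K (u j) + if j = i then t else 0 := by
  apply le_antisymm
  · obtain ⟨⟨y, hy, hyj⟩, -⟩ := suppFn_isGreatest hK (u j)
    have hmem : x₀ + c • y ∈ movedPoly K u i t := heq ▸ ⟨y, hy, rfl⟩
    have := hmem j
    rw [inner_add_left, real_inner_smul_left] at this
    rwa [← hyj] at this ⊢
  · obtain ⟨q, hq, hqj⟩ : ∃ q ∈ movedPoly K u i t,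
        ⟪q, u j⟫ = suppFn K (u j) + if j = i then t else 0 := by
      by_cases hji : j = i
      · subst hji
        refine ⟨x + t • u j, fun k => ?_, ?_⟩
        · rw [inner_add_left, real_inner_smul_left]
          by_cases hk : k = j
          · subst hk
            simp [hxi, hu]
          · have h1 : ⟪u j, u k⟫ ≤ 1 := by
              simpa [hu] using real_inner_le_norm (u j) (u k)
            have h2 := mul_le_mul_of_nonneg_left h1 ht.le
            rw [if_neg hk]
            linarith [hxt k hk]
        · simp [inner_add_left, real_inner_smul_left, hxi, hu]
      · obtain ⟨⟨y, hy, hyj⟩, -⟩ := suppFn_isGreatest hK (u j)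
        refine ⟨y, fun k => ?_, by simpa [hji] using hyj⟩
        have := inner_le_suppFn hK hy (u k)
        split_ifs <;> linarith
    rw [heq] at hq
    obtain ⟨y, hy, rfl⟩ := hq
    rw [← hqj, inner_add_left, real_inner_smul_left]
    have := mul_le_mul_of_nonneg_left (inner_le_suppFn hK hy (u j)) hc.le
    linarith

/-- If for every facet of an `n`-polytope `K` and all sufficiently small `t ≠ 0` the polytope
obtained by translating that facet's supporting hyperplane by `t` is homothetic to `K`, then
`K` is a simplex. -/
theorem simplex_of_homothetic_facet_moves (n N : ℕ) (hn : 1 ≤ n)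
    (K : Set (EuclideanSpace ℝ (Fin n))) (hK : IsConvexBody K)
    (hKdim : (interior K).Nonempty)
    (hKpoly : ∃ s : Finset (EuclideanSpace ℝ (Fin n)), K = convexHull ℝ (s : Set _))
    (u : Fin N → EuclideanSpace ℝ (Fin n)) (hu : ∀ j, ‖u j‖ = 1)
    (huinj : Function.Injective u)
    (hKrep : K = ⋂ j : Fin N, {x | ⟪x, u j⟫ ≤ suppFn K (u j)})
    (hfacet : ∀ j : Fin N, μH[(n : ℝ) - 1] (K ∩ {x | ⟪x, u j⟫ = suppFn K (u j)}) ≠ 0)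
    (hhom : ∀ i : Fin N, ∃ δ : ℝ, 0 < δ ∧ ∀ t : ℝ, t ≠ 0 → |t| < δ →
      ∃ c : ℝ, 0 < c ∧ ∃ x₀ : EuclideanSpace ℝ (Fin n),
        movedPoly K u i t = (fun y => x₀ + c • y) '' K) :
    ∃ p : Fin (n + 1) → EuclideanSpace ℝ (Fin n),
      AffineIndependent ℝ p ∧ K = convexHull ℝ (Set.range p) := by
  have hrep : ∀ x, x ∈ K ↔ ∀ j, ⟪x, u j⟫ ≤ suppFn K (u j) := by
    intro x
    conv_lhs => rw [hKrep]
    simp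
  have hbdd := hK.2.1.isBounded
  have : NeZero n := ⟨by omega⟩
  have hnt : K.Nontrivial := by
    by_contra h
    have hss := Set.not_nontrivial_iff.mp h
    obtain ⟨z, hz⟩ := hKdim
    have hKz : K = {z} := hss.eq_singleton_of_mem (interior_subset hz)
    rw [hKz, interior_singleton] at hz
    exact hz
  have hvertex : ∀ i, ∃ (p : EuclideanSpace ℝ (Fin n)) (r : ℝ), 0 < r ∧
      ∀ j, ⟪p, u j⟫ = suppFn K (u j) - if j = i then r else 0 := by
    intro i
    obtain ⟨x, hx, hxi, hxlt⟩ := exists_mem_facet_forall_lt hn hK hKdim hu huinj i (hfacet i)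
    obtain ⟨δ, hδ, hmove⟩ := hhom i
    have hev : ∀ᶠ t : ℝ in nhdsWithin 0 (Set.Ioi 0),
        0 < t ∧ t < δ ∧ ∀ j, j ≠ i → ⟪x, u j⟫ + t ≤ suppFn K (u j) := by
      refine Filter.Eventually.and self_mem_nhdsWithin (Filter.Eventually.and
        (nhdsWithin_le_nhds (eventually_lt_nhds hδ)) (Filter.eventually_all.mpr fun j => ?_))
      by_cases hj : j = i
      · simp [hj]
      · filter_upwards [nhdsWithin_le_nhds (eventually_lt_nhds (sub_pos.mpr (hxlt j hj)))]
          with t ht _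
        linarith
    obtain ⟨t, ht, htδ, hxt⟩ := hev.exists
    obtain ⟨c, hc, x₀, heq⟩ := hmove t ht.ne' (by rwa [abs_of_pos ht])
    have hsupp := inner_add_mul_suppFn_of_movedPoly_eq hK hu hxi ht hxt hc heq
    have hc1 : 0 < c - 1 := by
      by_contra! hle
      obtain ⟨h0, h1⟩ := eq_zero_of_homogenization hbdd hnt hrep (y := -x₀) hle fun j => by
        have := hsupp j
        rw [inner_neg_left]
        split_ifs at this <;> linarith
      have := hsupp i
      rw [neg_eq_zero.mp h0, sub_eq_zero.mp h1, inner_zero_left, if_pos rfl] at this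
      linarith
    refine ⟨-(c - 1)⁻¹ • x₀, t / (c - 1), div_pos ht hc1, fun j => ?_⟩
    rw [real_inner_smul_left, eq_sub_of_add_eq (hsupp j)]
    split_ifs <;> field_simp <;> ring
  choose p r hr hp using hvertex
  obtain ⟨hind, hKp⟩ := affineIndependent_and_eq_convexHull hK.1 hbdd hnt hrep hr hp
  have hspan : affineSpan ℝ (Set.range p) = ⊤ :=
    interior_convexHull_nonempty_iff_affineSpan_eq_top.mp (hKp ▸ hKdim)
  have hcard : N = n + 1 := by
    have : Nonempty (Fin N) := by
      by_contra h
      rw [not_nonempty_iff] at h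
      exact hnt.nonempty.ne_empty (by rw [hKp, Set.range_eq_empty, convexHull_empty])
    simpa using hind.affineSpan_eq_top_iff_card_eq_finrank_add_one.mp hspan
  subst hcard
  exact ⟨p, hind, hKp⟩
end
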